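/- Every infinite-dimensional Banach space X has an infinite-dimensional quotient of subspace Y (i.e. Y = Z/W for closed subspaces W ⊆ Z ⊆ X) satisfying one of the two following mutually exclusive properties: (i) Y has an unconditional Schauder basis; (ii) Y admits a finite-dimensional decomposition with respect to which Y has the restricted QHI property. -/

import Mathlib

open Filter Topology

noncomputable section

/-- Two subspaces `U`, `V` form a topological direct sum. -/
def IsTopDirectSum {E : Type*} [SeminormedAddCommGroup E] [NormedSpace ℝ E]
    (U V : Submodule ℝ E) : Prop :=
  U ⊓ V = ⊥ ∧ IsClosed ((U ⊔ V : Submodule ℝ E) : Set E) ∧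
    ∃ C : ℝ, ∀ u ∈ U, ∀ v ∈ V, ‖u‖ ≤ C * ‖u + v‖

/-- A Banach space is decomposable if it is the topological direct sum of two
infinite-dimensional closed subspaces. -/
def Decomposable (E : Type*) [SeminormedAddCommGroup E] [NormedSpace ℝ E] : Prop :=
  ∃ U V : Submodule ℝ E, IsClosed (U : Set E) ∧ IsClosed (V : Set E) ∧
    ¬FiniteDimensional ℝ U ∧ ¬FiniteDimensional ℝ V ∧ U ⊔ V = ⊤ ∧ IsTopDirectSum U V

/-- Hereditarily indecomposable space. -/
def IsHI (E : Type*) [SeminormedAddCommGroup E] [NormedSpace ℝ E] : Prop :=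
  ¬FiniteDimensional ℝ E ∧
    ∀ Y : Submodule ℝ E, IsClosed (Y : Set E) → ¬ Decomposable ↥Y

/-- A finite-dimensional decomposition (FDD) of a Banach space: a sequence of nonzero
finite-dimensional subspaces such that every vector has a unique norm-convergent
expansion `x = Σ b n` with `b n ∈ B n`. -/
def IsFDD {E : Type*} [SeminormedAddCommGroup E] [NormedSpace ℝ E]
    (B : ℕ → Submodule ℝ E) : Prop :=
  (∀ n, B n ≠ ⊥) ∧ (∀ n, FiniteDimensional ℝ (B n)) ∧
    ∀ x : E, ∃! b : (n : ℕ) → B n,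
      Tendsto (fun N => ∑ n ∈ Finset.range N, ((b n : E))) atTop (𝓝 x)

/-- A successive partition of `ℕ` into intervals, encoded by its sequence of left endpoints:
the `n`-th interval is `[k n, k (n+1))`. -/
def SuccPartition (k : ℕ → ℕ) : Prop :=
  StrictMono k ∧ k 0 = 0

/-- An FDD-block subspace of a space with FDD `B`: the closed span of a sequence of
finitely supported (possibly zero) subspaces `F n` with `ran (F n) ⊆ E n` for some
successive partition. -/
def IsFDDBlockSubspace {E : Type*} [SeminormedAddCommGroup E] [NormedSpace ℝ E]
    (B : ℕ → Submodule ℝ E) (Y : Submodule ℝ E) : Prop :=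
  ∃ k : ℕ → ℕ, SuccPartition k ∧ ∃ F : ℕ → Submodule ℝ E,
    (∀ n, F n ≤ ⨆ i ∈ Finset.Ico (k n) (k (n + 1)), B i) ∧
    Y = (⨆ n, F n).topologicalClosure

/-- The FDD-block quotient of subspace `Σ F n / Σ G n`, as a quotient Banach space. -/
abbrev fddQS {E : Type*} [SeminormedAddCommGroup E] [NormedSpace ℝ E]
    (F G : ℕ → Submodule ℝ E) : Type _ :=
  ↥((⨆ n, F n).topologicalClosure) ⧸
    (((⨆ n, G n).topologicalClosure).comap ((⨆ n, F n).topologicalClosure).subtype)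

/-- The restricted QHI property of a space with FDD `B`: no infinite-dimensional
FDD-block quotient of subspace is decomposable. -/
def RestrictedQHI {E : Type*} [SeminormedAddCommGroup E] [NormedSpace ℝ E]
    (B : ℕ → Submodule ℝ E) : Prop :=
  ∀ k : ℕ → ℕ, SuccPartition k →
    ∀ F G : ℕ → Submodule ℝ E, (∀ n, G n ≤ F n) →
      (∀ n, F n ≤ ⨆ i ∈ Finset.Ico (k n) (k (n + 1)), B i) →
      ¬FiniteDimensional ℝ (fddQS F G) → ¬ Decomposable (fddQS F G)

end

noncomputable section

/-- A Schauder basis: every vector has a unique norm-convergent expansion. -/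
def IsSchauderBasis {E : Type*} [SeminormedAddCommGroup E] [NormedSpace ℝ E]
    (e : ℕ → E) : Prop :=
  ∀ x : E, ∃! c : ℕ → ℝ,
    Tendsto (fun N => ∑ n ∈ Finset.range N, c n • e n) atTop (𝓝 x)

/-- A `C`-unconditional Schauder basis. -/
def IsUnconditionalSchauderBasis {E : Type*} [SeminormedAddCommGroup E] [NormedSpace ℝ E]
    (C : ℝ) (e : ℕ → E) : Prop :=
  IsSchauderBasis e ∧ 1 ≤ C ∧
    ∀ (c : ℕ → ℝ) (x : E),
      Tendsto (fun N => ∑ n ∈ Finset.range N, c n • e n) atTop (𝓝 x) →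
      ∀ ε : ℕ → ℝ, (∀ n, ε n = 1 ∨ ε n = -1) →
        ∃ y : E, Tendsto (fun N => ∑ n ∈ Finset.range N, (ε n * c n) • e n) atTop (𝓝 y) ∧
          ‖y‖ ≤ C * ‖x‖

/-- Linear span of the vectors `x i` with `a ≤ i < b`. -/
def sp {X : Type*} [AddCommGroup X] [Module ℝ X] (x : ℕ → X) (a b : ℕ) : Submodule ℝ X :=
  Submodule.span ℝ (x '' Set.Ico a b)

/-- Linear span of the vectors `x i` with `a ≤ i`. -/
def high {X : Type*} [AddCommGroup X] [Module ℝ X] (x : ℕ → X) (a : ℕ) : Submodule ℝ X :=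
  Submodule.span ℝ (x '' Set.Ici a)

/-- A sequence of nonzero vectors whose initial projections have norm at most two. -/
def BK {X : Type*} [SeminormedAddCommGroup X] [NormedSpace ℝ X] (x : ℕ → X) : Prop :=
  (∀ n, x n ≠ 0) ∧ ∀ m, ∀ y ∈ sp x 0 m, ∀ τ ∈ high x m, ‖y‖ ≤ 2 * ‖y + τ‖

section
variable {X : Type*} [AddCommGroup X] [Module ℝ X] (x : ℕ → X)

theorem sp_mono {a b a' b' : ℕ} (h : a' ≤ a) (h' : b ≤ b') : sp x a b ≤ sp x a' b' :=
  Submodule.span_mono (Set.image_mono (Set.Ico_subset_Ico h h'))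

theorem sp_le_high {a b c : ℕ} (h : c ≤ a) : sp x a b ≤ high x c :=
  Submodule.span_mono (Set.image_mono fun _ hi => h.trans hi.1)

theorem sp_succ {a b : ℕ} (h : a ≤ b) : sp x a (b + 1) = sp x a b ⊔ Submodule.span ℝ {x b} := by
  unfold sp
  rw [← Submodule.span_union, ← Set.image_singleton, ← Set.image_union]
  congr 2
  ext i; simp; omega

theorem sp_self (a : ℕ) : sp x a a = ⊥ := by simp [sp]

instance sp_fd (a b : ℕ) : FiniteDimensional ℝ (sp x a b) :=
  FiniteDimensional.span_of_finite ℝ ((Set.finite_Ico a b).image x)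

theorem exists_sp_of_mem_high {a : ℕ} {y : X} (hy : y ∈ high x a) : ∃ b, a ≤ b ∧ y ∈ sp x a b := by
  have : high x a = ⨆ n : ℕ, sp x a (a + n) := by
    unfold sp high
    rw [← Submodule.span_iUnion, ← Set.image_iUnion]
    congr 2
    ext i
    simp only [Set.mem_Ici, Set.mem_iUnion, Set.mem_Ico]
    exact ⟨fun h => ⟨i + 1, h, by omega⟩, fun ⟨_, h, _⟩ => h⟩
  rw [this, Submodule.mem_iSup_of_directed] at hy
  · obtain ⟨n, hn⟩ := hy
    exact ⟨a + n, by omega, hn⟩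
  · exact Monotone.directed_le fun i j hij => sp_mono x le_rfl (by omega)

end

theorem exists_almost_orthogonal {X : Type*} [NormedAddCommGroup X] [NormedSpace ℝ X]
    (hX : ¬FiniteDimensional ℝ X) (A : Submodule ℝ X) [FiniteDimensional ℝ A] {c : ℝ}
    (hc : 1 < c) : ∃ x : X, x ≠ 0 ∧ ∀ a ∈ A, ∀ t : ℝ, ‖a‖ ≤ c * ‖a + t • x‖ := by
  have hc0 : 0 < c := by linarith
  have hS : IsCompact (((↑) : A → X) '' Metric.sphere 0 1) :=
    (isCompact_sphere _ _).image continuous_subtype_val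
  have hδ : 0 < 1 - c⁻¹ := by
    have := inv_lt_one_of_one_lt₀ hc
    linarith
  obtain ⟨N, hNS, hN, hcov⟩ := hS.finite_cover_balls hδ
  have : Fintype N := hN.fintype
  choose g hg1 hg2 using fun n : X => exists_dual_vector'' ℝ n
  let T : X →ₗ[ℝ] (N → ℝ) := LinearMap.pi fun n => (g n).toLinearMap
  have hT : ¬Function.Injective T := fun h => hX (Module.Finite.of_injective T h)
  obtain ⟨x, hx, hx0⟩ : ∃ x, T x = 0 ∧ x ≠ 0 := by
    by_contra! h
    exact hT ((injective_iff_map_eq_zero T).2 h)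
  refine ⟨x, hx0, fun a ha t => ?_⟩
  have key : ∀ b ∈ A, ‖b‖ = 1 → ∀ s : ℝ, c⁻¹ ≤ ‖b + s • x‖ := by
    intro b hb hb1 s
    obtain ⟨n, hn, hbn⟩ : ∃ n ∈ N, b ∈ Metric.ball n (1 - c⁻¹) := by
      simpa using hcov ⟨⟨b, hb⟩, by simpa using hb1, rfl⟩
    have hn1 : ‖n‖ = 1 := by
      obtain ⟨m, hm, rfl⟩ := hNS hn
      simpa using hm
    have hgx : g n x = 0 := congrFun hx ⟨n, hn⟩
    have h1 : g n (b + s • x) = g n (b - n) + 1 := by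
      have := hg2 n
      simp only [map_add, map_smul, map_sub, hgx, this, hn1]
      simp
    have h2 : ‖g n (b - n)‖ ≤ ‖b - n‖ := (g n).le_of_opNorm_le_of_le (hg1 n) le_rfl |>.trans
      (by simp)
    have h3 : ‖g n (b + s • x)‖ ≤ ‖b + s • x‖ :=
      (g n).le_of_opNorm_le_of_le (hg1 n) le_rfl |>.trans (by simp)
    rw [mem_ball_iff_norm] at hbn
    rw [h1, Real.norm_eq_abs] at h3
    rw [Real.norm_eq_abs] at h2
    have := neg_abs_le (g n (b - n))
    have := le_abs_self (g n (b - n) + 1)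
    linarith
  rcases eq_or_ne a 0 with rfl | ha0
  · simp; positivity
  have hpos : 0 < ‖a‖ := norm_pos_iff.2 ha0
  have := key (‖a‖⁻¹ • a) (A.smul_mem _ ha) (by rw [norm_smul]; simp [hpos.ne']) (‖a‖⁻¹ * t)
  rw [mul_smul, ← smul_add, norm_smul, norm_inv, norm_norm, inv_mul_eq_div,
    le_div_iff₀ hpos, inv_mul_le_iff₀ hc0] at this
  exact this

theorem exists_BK (X : Type*) [NormedAddCommGroup X] [NormedSpace ℝ X]
    (hX : ¬FiniteDimensional ℝ X) : ∃ x : ℕ → X, BK x := by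
  let d : ℕ → ℝ := fun n => 2 - (1 / 2) ^ n
  have hd1 : ∀ n, 1 ≤ d n := fun n => by
    have : (1 / 2 : ℝ) ^ n ≤ 1 := pow_le_one₀ (by norm_num) (by norm_num)
    simp only [d]; linarith
  have hd2 : ∀ n, d n ≤ 2 := fun n => by
    have : (0 : ℝ) ≤ (1 / 2 : ℝ) ^ n := by positivity
    simp only [d]; linarith
  have hd : ∀ n, d n < d (n + 1) := fun n => by
    have : (0 : ℝ) < (1 / 2 : ℝ) ^ n := by positivity
    simp only [d, pow_succ]; linarith
  have hd0 : ∀ n, 0 < d n := fun n => by linarith [hd1 n]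
  have pick : ∀ (n : ℕ) (A : Submodule ℝ X), ∃ x : X, FiniteDimensional ℝ A →
      x ≠ 0 ∧ ∀ a ∈ A, ∀ t : ℝ, ‖a‖ ≤ d (n + 1) / d n * ‖a + t • x‖ := by
    intro n A
    by_cases hA : FiniteDimensional ℝ A
    · obtain ⟨x, hx⟩ := exists_almost_orthogonal hX A
        (c := d (n + 1) / d n) ((one_lt_div (hd0 n)).2 (hd n))
      exact ⟨x, fun _ => hx⟩
    · exact ⟨0, fun h => absurd h hA⟩
  choose pk hpk using pick
  let A : ℕ → Submodule ℝ X := fun n =>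
    Nat.rec ⊥ (fun n A => A ⊔ Submodule.span ℝ {pk n A}) n
  let x : ℕ → X := fun n => pk n (A n)
  have hA : ∀ n, A n = sp x 0 n := by
    intro n
    induction n with
    | zero => rw [sp_self]; rfl
    | succ n ih => rw [sp_succ x (Nat.zero_le n), ← ih]
  have hx : ∀ n, x n ≠ 0 ∧ ∀ a ∈ sp x 0 n, ∀ t : ℝ, ‖a‖ ≤ d (n + 1) / d n * ‖a + t • x n‖ := by
    intro n
    have h1 := hpk n (A n) (by rw [hA]; infer_instance)
    refine ⟨h1.1, fun a ha => h1.2 a (by rw [hA]; exact ha)⟩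
  refine ⟨x, fun n => (hx n).1, fun m y hy τ hτ => ?_⟩
  obtain ⟨b, hmb, hτ⟩ := exists_sp_of_mem_high x hτ
  have main : ∀ n, m ≤ n → ∀ τ ∈ sp x m n, ‖y‖ ≤ d n / d m * ‖y + τ‖ := by
    intro n hn
    induction n, hn using Nat.le_induction with
    | base =>
      intro τ hτ
      rw [sp_self, Submodule.mem_bot] at hτ
      simp [hτ, div_self (hd0 m).ne']
    | succ n hn ih =>
      intro τ hτ
      rw [sp_succ x hn] at hτ
      obtain ⟨σ, hσ, ρ, hρ, rfl⟩ := Submodule.mem_sup.1 hτ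
      obtain ⟨t, rfl⟩ := Submodule.mem_span_singleton.1 hρ
      have h1 := ih σ hσ
      have h2 := (hx n).2 (y + σ) (add_mem (sp_mono x le_rfl hn hy)
        (sp_mono x (Nat.zero_le m) le_rfl hσ)) t
      calc ‖y‖ ≤ d n / d m * ‖y + σ‖ := h1
        _ ≤ d n / d m * (d (n + 1) / d n * ‖y + σ + t • x n‖) := by
            have := hd0 n; have := hd0 m
            gcongr
        _ = d (n + 1) / d m * ‖y + (σ + t • x n)‖ := by
            have := (hd0 n).ne'; have := (hd0 m).ne'
            rw [add_assoc]; field_simp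
  refine (main b hmb τ hτ).trans ?_
  gcongr
  rw [div_le_iff₀ (hd0 m)]
  linarith [hd1 m, hd2 b]

section
variable {X : Type*} [NormedAddCommGroup X] [NormedSpace ℝ X] {x : ℕ → X}

theorem BK.disjoint (hx : BK x) (m : ℕ) : Disjoint (sp x 0 m) (high x m) := by
  rw [Submodule.disjoint_def]
  intro y hy hy'
  have := hx.2 m y hy (-y) (neg_mem hy')
  simp at this
  exact this

theorem BK.exists_proj (hx : BK x) (m : ℕ) : ∃ Q : X →ₗ[ℝ] X,
    (∀ y ∈ sp x 0 m, Q y = y) ∧ ∀ y ∈ high x m, Q y = 0 := by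
  obtain ⟨K, hK1, hK2⟩ := (hx.disjoint m).symm.exists_isCompl
  refine ⟨(sp x 0 m).subtype ∘ₗ (sp x 0 m).projectionOnto K hK2.symm, fun y hy => ?_,
    fun y hy => ?_⟩
  · simp [Submodule.projectionOnto_apply_left hK2.symm ⟨y, hy⟩]
  · simp [hK1 hy]

end

/-- An interval `[s, t)` of integers together with a pair of subspaces. -/
structure Blk (X : Type*) [AddCommGroup X] [Module ℝ X] where
  s : ℕ
  t : ℕ
  F : Submodule ℝ X
  G : Submodule ℝ X

section
variable {X : Type*} [AddCommGroup X] [Module ℝ X]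

/-- Consecutive blocks of the sequence `x`, with `G` strictly contained in `F`. -/
def IsSeq (x : ℕ → X) (p : ℕ → Blk X) : Prop :=
  ∀ n, (p n).s < (p n).t ∧ (p n).t = (p (n + 1)).s ∧ (p n).G < (p n).F ∧
    (p n).F ≤ sp x (p n).s (p n).t

/-- The block `b` is obtained by merging consecutive terms of `p`, shrinking the
numerator and enlarging the denominator. -/
structure Made (b : Blk X) (p : ℕ → Blk X) : Prop where
  s_eq : ∃ a, b.s = (p a).s
  t_eq : ∃ c, b.t = (p c).s
  lt : b.s < b.t
  G_le : ∀ i, b.s ≤ (p i).s → (p i).t ≤ b.t → (p i).G ≤ b.G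
  G_lt : b.G < b.F
  F_le : b.F ≤ ⨆ i, ⨆ _ : b.s ≤ (p i).s ∧ (p i).t ≤ b.t, (p i).F

/-- Every term of `q` is made from `p`. -/
def BLe (q p : ℕ → Blk X) : Prop := ∀ n, Made (q n) p

variable {x : ℕ → X} {p q r u : ℕ → Blk X} {b : Blk X}

theorem exists_between_of_strictMono {f : ℕ → ℕ} (hf : StrictMono f) {n : ℕ} (h : f 0 ≤ n) :
    ∃ j, f j ≤ n ∧ n < f (j + 1) := by
  have hex : ∃ j, n < f (j + 1) := ⟨n, lt_of_lt_of_le n.lt_succ_self (hf.id_le _)⟩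
  refine ⟨Nat.find hex, ?_, Nat.find_spec hex⟩
  rcases Nat.eq_zero_or_pos (Nat.find hex) with h0 | h0
  · rw [h0]; exact h
  · have := Nat.find_min hex (m := Nat.find hex - 1) (by omega)
    rw [Nat.sub_add_cancel h0] at this
    omega

theorem IsSeq.strictMono (hp : IsSeq x p) : StrictMono fun n => (p n).s :=
  strictMono_nat_of_lt_succ fun n => by
    have := (hp n).1
    rw [(hp n).2.1] at this
    exact this

theorem IsSeq.s_lt_iff (hp : IsSeq x p) {i j : ℕ} : (p i).s < (p j).s ↔ i < j :=
  hp.strictMono.lt_iff_lt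

theorem IsSeq.s_le_iff (hp : IsSeq x p) {i j : ℕ} : (p i).s ≤ (p j).s ↔ i ≤ j :=
  hp.strictMono.le_iff_le

theorem IsSeq.t_eq (hp : IsSeq x p) (i : ℕ) : (p i).t = (p (i + 1)).s := (hp i).2.1

theorem IsSeq.G_le_F (hp : IsSeq x p) (i : ℕ) : (p i).G ≤ (p i).F := (hp i).2.2.1.le

theorem IsSeq.refl (hp : IsSeq x p) : BLe p p := by
  intro n
  have hn : ∀ i, (p n).s ≤ (p i).s → (p i).t ≤ (p n).t → i = n := by
    intro i h1 h2
    rw [hp.t_eq, hp.t_eq] at h2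
    have := hp.s_le_iff.1 h1
    have := hp.s_le_iff.1 h2
    omega
  refine ⟨⟨n, rfl⟩, ⟨n + 1, hp.t_eq n⟩, (hp n).1, fun i h1 h2 => by rw [hn i h1 h2],
    (hp n).2.2.1, le_iSup₂_of_le n ⟨le_rfl, le_rfl⟩ le_rfl⟩

theorem IsSeq.tail (hp : IsSeq x p) (k : ℕ) : IsSeq x fun n => p (n + k) := by
  intro n
  have := hp (n + k)
  rw [add_right_comm n k 1] at this
  exact this

theorem BLe.tail (h : BLe q p) (k : ℕ) : BLe (fun n => q (n + k)) p := fun n => h (n + k)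

theorem Made.F_le_sp (h : Made b p) (hp : IsSeq x p) : b.F ≤ sp x b.s b.t := by
  refine h.F_le.trans (iSup₂_le fun i hi => (hp i).2.2.2.trans (sp_mono x hi.1 hi.2))

theorem IsSeq.of_made (hp : IsSeq x p) (h : BLe q p) (ht : ∀ n, (q n).t = (q (n + 1)).s) :
    IsSeq x q :=
  fun n => ⟨(h n).lt, ht n, (h n).G_lt, (h n).F_le_sp hp⟩

theorem Made.trans (hb : Made b q) (hq : BLe q p) (hqs : IsSeq x q) (hps : IsSeq x p) :
    Made b p := by
  obtain ⟨a, ha⟩ := hb.s_eq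
  obtain ⟨c, hc⟩ := hb.t_eq
  refine ⟨?_, ?_, hb.lt, ?_, hb.G_lt, ?_⟩
  · rw [ha]; exact (hq a).s_eq
  · rw [hc]; exact (hq c).s_eq
  · intro i h1 h2
    have h0 : (q 0).s ≤ (p i).s :=
      le_trans (by rw [ha]; exact hqs.s_le_iff.2 (Nat.zero_le a)) h1
    obtain ⟨j, hj1, hj2⟩ := exists_between_of_strictMono hqs.strictMono h0
    have hj3 : (p i).t ≤ (q j).t := by
      obtain ⟨e, he⟩ := (hq j).t_eq
      rw [hqs.t_eq] at he ⊢
      simp only [he] at hj2 ⊢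
      rw [hps.t_eq]
      exact hps.s_le_iff.2 (hps.s_lt_iff.1 hj2)
    have hj4 : b.s ≤ (q j).s := by
      rw [ha] at h1 ⊢
      have := hqs.s_lt_iff.1 (lt_of_le_of_lt h1 hj2)
      exact hqs.s_le_iff.2 (by omega)
    have hj5 : (q j).t ≤ b.t := by
      have h3 := lt_of_lt_of_le (hps i).1 h2
      rw [hc] at h3 ⊢
      have := hqs.s_lt_iff.1 (lt_of_le_of_lt hj1 h3)
      rw [hqs.t_eq]
      exact hqs.s_le_iff.2 (by omega)
    exact ((hq j).G_le i hj1 hj3).trans (hb.G_le j hj4 hj5)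
  · refine hb.F_le.trans (iSup₂_le fun j hj => (hq j).F_le.trans (iSup₂_le fun i hi => ?_))
    exact le_iSup₂_of_le i ⟨hj.1.trans hi.1, hi.2.trans hj.2⟩ le_rfl

theorem BLe.trans (h : BLe r q) (hq : BLe q p) (hqs : IsSeq x q) (hps : IsSeq x p) :
    BLe r p := fun n => (h n).trans hq hqs hps

theorem Made.of_tail_le (hb : Made b p) (hp : IsSeq x p) {k : ℕ} (hk : (p k).s ≤ b.s) :
    Made b fun n => p (n + k) := by
  obtain ⟨a, ha⟩ := hb.s_eq
  obtain ⟨c, hc⟩ := hb.t_eq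
  have hak : k ≤ a := by rw [ha] at hk; exact hp.s_le_iff.1 hk
  have hac : a < c := by have := hb.lt; rw [ha, hc] at this; exact hp.s_lt_iff.1 this
  refine ⟨⟨a - k, by rw [ha, Nat.sub_add_cancel hak]⟩,
    ⟨c - k, by rw [hc, Nat.sub_add_cancel (by omega)]⟩, hb.lt,
    fun i h1 h2 => hb.G_le _ h1 h2, hb.G_lt, hb.F_le.trans (iSup₂_le fun i hi => ?_)⟩
  have hik : k ≤ i := hp.s_le_iff.1 (hk.trans hi.1)
  refine le_iSup₂_of_le (i - k) ?_ ?_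
  · rw [Nat.sub_add_cancel hik]; exact hi
  · rw [Nat.sub_add_cancel hik]

theorem BLe.of_tail_le (h : BLe u p) (hu : IsSeq x u) (hp : IsSeq x p) {k : ℕ}
    (hk : (p k).s ≤ (u 0).s) : BLe u fun n => p (n + k) :=
  fun n => (h n).of_tail_le hp (hk.trans (hu.s_le_iff.2 (Nat.zero_le n)))

/-- The first `k` terms of `p` followed by `r`. -/
def splice (p : ℕ → Blk X) (k : ℕ) (r : ℕ → Blk X) (n : ℕ) : Blk X :=
  if n < k then p n else r (n - k)

theorem splice_of_lt {k n : ℕ} (h : n < k) : splice p k r n = p n := if_pos h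

theorem splice_add (k n : ℕ) : splice p k r (n + k) = r n := by simp [splice]

theorem splice_tail (k : ℕ) : (fun n => splice p k r (n + k)) = r := funext fun n => splice_add k n

theorem splice_self (k : ℕ) : splice p k r k = r 0 := by
  simpa using splice_add (p := p) (r := r) k 0

theorem splice_le (hp : IsSeq x p) (hr : BLe r p) (k : ℕ) : BLe (splice p k r) p := by
  intro n
  unfold splice
  split_ifs
  · exact hp.refl n
  · exact hr _

theorem splice_isSeq (hp : IsSeq x p) (hr : IsSeq x r) {k : ℕ} (h : (r 0).s = (p k).s) :
    IsSeq x (splice p k r) := by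
  intro n
  rcases lt_trichotomy (n + 1) k with h1 | h1 | h1
  · rw [splice_of_lt h1, splice_of_lt (by omega)]; exact hp n
  · subst h1
    rw [splice_of_lt n.lt_succ_self, splice_self, h]; exact hp n
  · obtain ⟨m, rfl⟩ := Nat.exists_eq_add_of_le' (Nat.lt_succ_iff.1 h1)
    rw [add_right_comm, splice_add, splice_add]; exact hr m

/-- The first sequence is below the second one and agrees with it up to the start of the
`k`-th block. -/
structure Refines (x : ℕ → X) (k : ℕ) (p' p : ℕ → Blk X) : Prop where
  isSeq : IsSeq x p'
  le : BLe p' p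
  eq : ∀ i < k, p' i = p i
  s_eq : (p' k).s = (p k).s

theorem Refines.refl (hp : IsSeq x p) (k : ℕ) : Refines x k p p :=
  ⟨hp, hp.refl, fun _ _ => rfl, rfl⟩

theorem Refines.trans {k : ℕ} (h : Refines x k r q) (h' : Refines x k q p) (hp : IsSeq x p) :
    Refines x k r p :=
  ⟨h.isSeq, h.le.trans h'.le h'.isSeq hp, fun i hi => (h.eq i hi).trans (h'.eq i hi),
    h.s_eq.trans h'.s_eq⟩

theorem refines_splice (hp : IsSeq x p) (hr : IsSeq x r) (hrp : BLe r p) {k : ℕ}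
    (h : (r 0).s = (p k).s) : Refines x k (splice p k r) p :=
  ⟨splice_isSeq hp hr h, splice_le hp hrp k, fun _ hi => splice_of_lt hi, by
    rw [splice_self, h]⟩

theorem fusion (Φ : (ℕ → Blk X) → ℕ → Prop)
    (h1 : ∀ p, IsSeq x p → ∀ k, ∃ p', Refines x k p' p ∧ Φ p' k)
    (h2 : ∀ p p' k, IsSeq x p → Refines x (k + 1) p' p → Φ p k → Φ p' k)
    (p₀ : ℕ → Blk X) (hp₀ : IsSeq x p₀) :
    ∃ p, IsSeq x p ∧ BLe p p₀ ∧ (p 0).s = (p₀ 0).s ∧ ∀ k, Φ p k := by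
  choose f hf1 hf2 using h1
  let P : ℕ → {p : ℕ → Blk X // IsSeq x p} := fun n =>
    Nat.rec ⟨p₀, hp₀⟩ (fun k q => ⟨f q.1 q.2 k, (hf1 q.1 q.2 k).isSeq⟩) n
  have hP : ∀ k, Refines x k (P (k + 1)).1 (P k).1 := fun k => hf1 _ _ k
  have hΦ : ∀ k, Φ (P (k + 1)).1 k := fun k => hf2 _ _ k
  have hle : ∀ i j, i ≤ j → BLe (P j).1 (P i).1 := by
    intro i j hij
    induction j, hij using Nat.le_induction with
    | base => exact (P i).2.refl
    | succ j hij ih => exact (hP j).le.trans ih (P j).2 (P i).2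
  have heq : ∀ n i j, n < i → i ≤ j → (P j).1 n = (P i).1 n := by
    intro n i j hni hij
    induction j, hij using Nat.le_induction with
    | base => rfl
    | succ j hij ih => rw [(hP j).eq n (by omega), ih]
  let p : ℕ → Blk X := fun n => (P (n + 1)).1 n
  have hpP : ∀ n j, n < j → p n = (P j).1 n := fun n j h => (heq n (n + 1) j (by omega) h).symm
  have hps : IsSeq x p := by
    intro n
    rw [hpP n (n + 2) (by omega), hpP (n + 1) (n + 2) (by omega)]
    exact (P (n + 2)).2 n
  have hpk : ∀ k, Refines x k p (P k).1 := by
    intro k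
    refine ⟨hps, fun n => ?_, fun i hi => hpP i k hi, (hP k).s_eq⟩
    rw [hpP n (n + 1 + k) (by omega)]
    exact hle k _ (by omega) n
  exact ⟨p, hps, (hpk 0).le, (hpk 0).s_eq, fun k => h2 _ _ k (P (k + 1)).2 (hpk (k + 1)) (hΦ k)⟩

end

section
variable {X : Type*} [SeminormedAddCommGroup X] [NormedSpace ℝ X]

theorem infDist_le_norm_sub {W : Submodule ℝ X} {w : X} (hw : w ∈ W) (y : X) :
    Metric.infDist y W ≤ ‖y - w‖ := by
  rw [← dist_eq_norm]; exact Metric.infDist_le_dist_of_mem hw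

theorem exists_norm_sub_lt (W : Submodule ℝ X) {y : X} {r : ℝ} (h : Metric.infDist y W < r) :
    ∃ w ∈ W, ‖y - w‖ < r := by
  obtain ⟨w, hw, h⟩ := (Metric.infDist_lt_iff ⟨0, W.zero_mem⟩).1 h
  exact ⟨w, hw, by rwa [← dist_eq_norm]⟩

theorem le_infDist_of_forall {W : Submodule ℝ X} {y : X} {r : ℝ} (h : ∀ w ∈ W, r ≤ ‖y - w‖) :
    r ≤ Metric.infDist y W := by
  refine (Metric.le_infDist ⟨0, W.zero_mem⟩).2 fun w hw => ?_
  rw [dist_eq_norm]; exact h w hw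

theorem infDist_anti {W W' : Submodule ℝ X} (h : W ≤ W') (y : X) :
    Metric.infDist y W' ≤ Metric.infDist y W :=
  Metric.infDist_le_infDist_of_subset h ⟨0, W.zero_mem⟩

theorem infDist_le_norm (W : Submodule ℝ X) (y : X) : Metric.infDist y W ≤ ‖y‖ := by
  simpa using infDist_le_norm_sub W.zero_mem y

theorem infDist_neg (W : Submodule ℝ X) (y : X) : Metric.infDist (-y) W = Metric.infDist y W := by
  have : ∀ y : X, Metric.infDist (-y) W ≤ Metric.infDist y W := fun y =>
    le_infDist_of_forall fun w hw => by
      have := infDist_le_norm_sub (W.neg_mem hw) (-y)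
      rwa [← neg_sub', norm_neg] at this
  exact le_antisymm (this y) (by simpa using this (-y))

theorem infDist_add_mem {W : Submodule ℝ X} {w : X} (hw : w ∈ W) (y : X) :
    Metric.infDist (y + w) W = Metric.infDist y W := by
  have : ∀ (y w : X), w ∈ W → Metric.infDist (y + w) W ≤ Metric.infDist y W := fun y w hw =>
    le_infDist_of_forall fun v hv => by
      simpa [add_comm w v] using infDist_le_norm_sub (W.add_mem hw hv) (y + w)
  refine le_antisymm (this y w hw) ?_
  simpa using this (y + w) (-w) (W.neg_mem hw)

theorem BK.infDist_le {x : ℕ → X} (hx : BK x) {m : ℕ} {W G : Submodule ℝ X} (hW : W ≤ sp x 0 m)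
    (hG : G ≤ high x m) {y τ : X} (hy : y ∈ sp x 0 m) (hτ : τ ∈ high x m) :
    Metric.infDist y W ≤ 2 * Metric.infDist (y + τ) (W ⊔ G : Submodule ℝ X) := by
  have : Metric.infDist y W / 2 ≤ Metric.infDist (y + τ) (W ⊔ G : Submodule ℝ X) := by
    refine le_infDist_of_forall fun v hv => ?_
    obtain ⟨w, hw, g, hg, rfl⟩ := Submodule.mem_sup.1 hv
    have h1 := hx.2 m (y - w) (sub_mem hy (hW hw)) (τ - g) (sub_mem hτ (hG hg))
    have h2 := infDist_le_norm_sub hw y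
    rw [show y - w + (τ - g) = y + τ - (w + g) by abel] at h1
    linarith
  linarith

/-- Modulo `W`, the subspaces `U` and `V` are separated. -/
def IsSep (C : ℝ) (U V W : Submodule ℝ X) : Prop :=
  ∀ u ∈ U, ∀ v ∈ V, Metric.infDist (u - v) W ≤ C * ‖u + v‖

theorem IsSep.symm {C : ℝ} {U V W : Submodule ℝ X} (h : IsSep C U V W) : IsSep C V U W := by
  intro v hv u hu
  rw [← neg_sub, infDist_neg, add_comm]
  exact h u hu v hv

theorem IsSep.mono {C C' : ℝ} (hC : C ≤ C') {U V W : Submodule ℝ X} (h : IsSep C U V W) :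
    IsSep C' U V W := fun u hu v hv => (h u hu v hv).trans (by gcongr)

/-- A triple of subspaces. -/
structure Tri (X : Type*) [AddCommGroup X] [Module ℝ X] where
  E : Submodule ℝ X
  F : Submodule ℝ X
  W : Submodule ℝ X

/-- Exchanging the first two subspaces. -/
def Tri.swap (t : Tri X) : Tri X := ⟨t.F, t.E, t.W⟩

/-- Admissible triples at level `m`. -/
structure Adm (x : ℕ → X) (m : ℕ) (t : Tri X) : Prop where
  WE : t.W ≤ t.E
  WF : t.W ≤ t.F
  E_le : t.E ≤ sp x 0 m
  F_le : t.F ≤ sp x 0 m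

/-- `u` and `v` witness the separation of an extension of `t` below `r`. -/
structure Wit (x : ℕ → X) (C : ℝ) (t : Tri X) (r : ℕ → Blk X) (m : ℕ) (u v : ℕ → Blk X) :
    Prop where
  hu : IsSeq x u
  hv : IsSeq x v
  ur : BLe u r
  vr : BLe v r
  s_zero : (u 0).s = m
  s_eq : ∀ n, (u n).s = (v n).s
  G_eq : ∀ n, (u n).G = (v n).G
  sep : IsSep C (t.E ⊔ ⨆ n, (u n).F) (t.F ⊔ ⨆ n, (v n).F) (t.W ⊔ ⨆ n, (u n).G)

/-- The triple `t` has a separated extension below `r` starting at `m`. -/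
def Dec (x : ℕ → X) (C : ℝ) (t : Tri X) (r : ℕ → Blk X) (m : ℕ) : Prop :=
  ∃ u v, Wit x C t r m u v

variable {x : ℕ → X} {C : ℝ} {t : Tri X} {r p : ℕ → Blk X} {m : ℕ} {u v : ℕ → Blk X}

theorem Wit.swap (h : Wit x C t r m u v) : Wit x C t.swap r m v u := by
  refine ⟨h.hv, h.hu, h.vr, h.ur, (h.s_eq 0).symm.trans h.s_zero, fun n => (h.s_eq n).symm,
    fun n => (h.G_eq n).symm, ?_⟩
  rw [← iSup_congr h.G_eq]
  exact h.sep.symm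

theorem Dec.swap (h : Dec x C t r m) : Dec x C t.swap r m := by
  obtain ⟨u, v, h⟩ := h
  exact ⟨v, u, h.swap⟩

theorem Wit.below (h : Wit x C t r m u v) (hr : IsSeq x r) (hp : IsSeq x p) (hrp : BLe r p) :
    Wit x C t p m u v :=
  { h with ur := h.ur.trans hrp hr hp, vr := h.vr.trans hrp hr hp }

theorem Dec.below (h : Dec x C t r m) (hr : IsSeq x r) (hp : IsSeq x p) (hrp : BLe r p) :
    Dec x C t p m := by
  obtain ⟨u, v, h⟩ := h
  exact ⟨u, v, h.below hr hp hrp⟩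

theorem Dec.mono {C' : ℝ} (hC : C ≤ C') (h : Dec x C t r m) : Dec x C' t r m := by
  obtain ⟨u, v, h⟩ := h
  exact ⟨u, v, { h with sep := h.sep.mono hC }⟩

theorem Dec.tail (h : Dec x C t r m) (hr : IsSeq x r) {k : ℕ} (hk : (r k).s = m) :
    Dec x C t (fun n => r (n + k)) m := by
  obtain ⟨u, v, h⟩ := h
  exact ⟨u, v, { h with
    ur := h.ur.of_tail_le h.hu hr (by rw [hk, h.s_zero])
    vr := h.vr.of_tail_le h.hv hr (by rw [hk, ← h.s_eq, h.s_zero]) }⟩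

theorem IsSeq.F_le_high (hu : IsSeq x u) {n m : ℕ} (h : m ≤ (u n).s) : (u n).F ≤ high x m :=
  (hu n).2.2.2.trans (sp_le_high x h)

theorem IsSeq.iSup_F_le_high (hu : IsSeq x u) {m : ℕ} (h : m ≤ (u 0).s) :
    ⨆ n, (u n).F ≤ high x m :=
  iSup_le fun n => hu.F_le_high (h.trans (hu.s_le_iff.2 (Nat.zero_le n)))

theorem IsSeq.iSup_G_le_high (hu : IsSeq x u) {m : ℕ} (h : m ≤ (u 0).s) :
    ⨆ n, (u n).G ≤ high x m :=
  (iSup_mono hu.G_le_F).trans (hu.iSup_F_le_high h)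

theorem Dec.sep (hx : BK x) (h : Dec x C t r m) (ht : Adm x m t) : IsSep (2 * C) t.E t.F t.W := by
  obtain ⟨u, v, h⟩ := h
  intro e he f hf
  have h1 := hx.infDist_le (ht.WE.trans ht.E_le) (h.hu.iSup_G_le_high h.s_zero.ge)
    (sub_mem (ht.E_le he) (ht.F_le hf)) (zero_mem _)
  have h2 := h.sep e (le_sup_left (α := Submodule ℝ X) he) f (le_sup_left (α := Submodule ℝ X) hf)
  rw [add_zero] at h1
  linarith

/-- Containment of one subspace in another up to a relative error `δ`. -/
def Approx (δ : ℝ) (S' S : Submodule ℝ X) : Prop := ∀ s' ∈ S', ∃ s ∈ S, ‖s - s'‖ ≤ δ * ‖s'‖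

theorem approx_arith {c δ N η K M : ℝ} (hc : 1 ≤ c) (hδ0 : 0 ≤ δ) (hδ1 : δ ≤ 1) (hN0 : 0 ≤ N)
    (hη : 0 ≤ η) (hK : K = 3 * c * N + η) (hM : M = c * (N + 2 * (δ * K)) + η) :
    M + 2 * (δ * K) + δ * (4 * K + 2 * M) ≤ (c + 38 * c ^ 2 * δ) * N + 15 * c * η := by
  have hc0 : 0 ≤ c := by linarith
  have k1 : c * N ≤ c ^ 2 * N := by
    have : 0 ≤ (c - 1) * (c * N) := mul_nonneg (by linarith) (by positivity)
    nlinarith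
  have k2 : η ≤ c * η := by nlinarith
  have hK0 : 0 ≤ K := by rw [hK]; positivity
  have hδK : δ * K ≤ K := by nlinarith
  have hM2 : M ≤ 7 * c ^ 2 * N + 3 * c * η := by
    have h : c * (δ * K) ≤ c * K := by gcongr
    have h' : c * K = 3 * (c ^ 2 * N) + c * η := by rw [hK]; ring
    rw [hM]; nlinarith
  have j1 : δ * (4 * K + 2 * M) ≤ δ * (26 * c ^ 2 * N + 10 * c * η) := by
    refine mul_le_mul_of_nonneg_left ?_ hδ0
    rw [hK]; nlinarith
  have j2 : M = c * N + 6 * (c ^ 2 * δ * N) + 2 * (c * (δ * η)) + η := by rw [hM, hK]; ring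
  have j3 : 2 * (δ * K) = 6 * (δ * (c * N)) + 2 * (δ * η) := by rw [hK]; ring
  have j4 : δ * (c * N) ≤ δ * (c ^ 2 * N) := by gcongr
  have j5 : δ * η ≤ η := by nlinarith
  have j6 : c * (δ * η) ≤ c * η := by gcongr
  have j7 : δ * (c * η) ≤ c * η := by
    have : 0 ≤ c * η := by positivity
    nlinarith
  nlinarith

theorem IsSep.of_approx (hx : BK x) {c δ : ℝ} (hc : 1 ≤ c) (hδ0 : 0 ≤ δ) (hδ1 : δ ≤ 1)
    {t t' : Tri X} {U V G : Submodule ℝ X} (ht : Adm x m t) (ht' : Adm x m t')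
    (hE : Approx δ t'.E t.E) (hF : Approx δ t'.F t.F) (hW : Approx δ t.W t'.W)
    (hU : U ≤ high x m) (hV : V ≤ high x m) (hG : G ≤ high x m)
    (hsep : IsSep c (t.E ⊔ U) (t.F ⊔ V) (t.W ⊔ G)) (hfin : IsSep (2 * c) t'.E t'.F t'.W) :
    IsSep (c + 38 * c ^ 2 * δ) (t'.E ⊔ U) (t'.F ⊔ V) (t'.W ⊔ G) := by
  intro y hy z hz
  obtain ⟨e', he', a, ha, rfl⟩ := Submodule.mem_sup.1 hy
  obtain ⟨f', hf', b, hb, rfl⟩ := Submodule.mem_sup.1 hz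
  set N := ‖e' + a + (f' + b)‖ with hN
  have hN0 : 0 ≤ N := norm_nonneg _
  refine le_of_forall_pos_le_add fun ε hε => ?_
  obtain ⟨η, hη, hηε⟩ : ∃ η > 0, 15 * c * η = ε := ⟨ε / (15 * c), by positivity, by field_simp⟩
  have h1 : ‖e' + f'‖ ≤ 2 * N := by
    have := hx.2 m (e' + f') (add_mem (ht'.E_le he') (ht'.F_le hf')) (a + b)
      (add_mem (hU ha) (hV hb))
    rwa [show e' + f' + (a + b) = e' + a + (f' + b) by abel] at this
  have h2 := hfin e' he' f' hf'
  obtain ⟨w', hw', h3⟩ := exists_norm_sub_lt t'.W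
    (show Metric.infDist (e' - f') t'.W < 4 * c * N + η by nlinarith)
  have hcN : N ≤ c * N := by nlinarith
  have he1m : e' - (2⁻¹ : ℝ) • w' ∈ t'.E := sub_mem he' (t'.E.smul_mem _ (ht'.WE hw'))
  have hf1m : f' + (2⁻¹ : ℝ) • w' ∈ t'.F := add_mem hf' (t'.F.smul_mem _ (ht'.WF hw'))
  set e1 := e' - (2⁻¹ : ℝ) • w' with he1
  set f1 := f' + (2⁻¹ : ℝ) • w' with hf1
  have hw2 : w' = (2⁻¹ : ℝ) • w' + (2⁻¹ : ℝ) • w' := by rw [← add_smul]; norm_num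
  have hsum : e1 + f1 = e' + f' := by rw [he1, hf1]; abel
  have hdiff : e1 - f1 = e' - f' - w' := by
    rw [he1, hf1]; nth_rewrite 3 [hw2]; abel
  have hne1 : ‖e1‖ ≤ 3 * c * N + η := by
    have : e1 = (2⁻¹ : ℝ) • ((e' + f') + (e' - f' - w')) := by
      rw [← hsum, ← hdiff, show e1 + f1 + (e1 - f1) = e1 + e1 by abel, smul_add, ← add_smul]
      norm_num
    rw [this, norm_smul]
    have := norm_add_le (e' + f') (e' - f' - w')
    norm_num
    linarith
  have hnf1 : ‖f1‖ ≤ 3 * c * N + η := by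
    have : f1 = (2⁻¹ : ℝ) • ((e' + f') - (e' - f' - w')) := by
      rw [← hsum, ← hdiff, show e1 + f1 - (e1 - f1) = f1 + f1 by abel, smul_add, ← add_smul]
      norm_num
    rw [this, norm_smul]
    have := norm_sub_le (e' + f') (e' - f' - w')
    norm_num
    linarith
  obtain ⟨e, he, h4⟩ := hE e1 he1m
  obtain ⟨f, hf, h5⟩ := hF f1 hf1m
  set K := 3 * c * N + η with hK
  have hK0 : 0 ≤ K := by positivity
  have h4' : ‖e - e1‖ ≤ δ * K := h4.trans (by gcongr)
  have h5' : ‖f - f1‖ ≤ δ * K := h5.trans (by gcongr)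
  have h6 : ‖e + a + (f + b)‖ ≤ N + 2 * (δ * K) := by
    rw [show e + a + (f + b) = (e' + a + (f' + b)) + ((e - e1) + (f - f1)) by
      rw [show (e - e1) + (f - f1) = e + f - (e1 + f1) by abel, hsum]; abel]
    refine (norm_add_le _ _).trans ?_
    have := norm_add_le (e - e1) (f - f1)
    linarith
  have h7 := hsep (e + a) (Submodule.add_mem_sup he ha) (f + b) (Submodule.add_mem_sup hf hb)
  obtain ⟨wg, hwg, h8⟩ := exists_norm_sub_lt (t.W ⊔ G)
    (show Metric.infDist (e + a - (f + b)) (t.W ⊔ G : Submodule ℝ X)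
      < c * (N + 2 * (δ * K)) + η by nlinarith)
  obtain ⟨w, hw, g, hg, rfl⟩ := Submodule.mem_sup.1 hwg
  have hδK : δ * K ≤ K := by nlinarith
  set M := c * (N + 2 * (δ * K)) + η with hM
  have h9 : ‖e - f - w‖ ≤ 2 * M := by
    have := hx.2 m (e - f - w) (sub_mem (sub_mem (ht.E_le he) (ht.F_le hf)) (ht.E_le (ht.WE hw)))
      (a - b - g) (sub_mem (sub_mem (hU ha) (hV hb)) (hG hg))
    rw [show e - f - w + (a - b - g) = e + a - (f + b) - (w + g) by abel] at this
    linarith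
  have h10 : ‖w‖ ≤ 4 * K + 2 * M := by
    have e1' : ‖e‖ ≤ 2 * K := by
      have := norm_le_norm_add_norm_sub e1 e
      rw [norm_sub_rev e1 e] at this
      linarith
    have f1' : ‖f‖ ≤ 2 * K := by
      have := norm_le_norm_add_norm_sub f1 f
      rw [norm_sub_rev f1 f] at this
      linarith
    have h := norm_sub_le (e - f) (e - f - w)
    rw [sub_sub_cancel] at h
    have := norm_sub_le e f
    linarith
  obtain ⟨w'', hw'', h11⟩ := hW w hw
  have h12 := infDist_le_norm_sub (W := t'.W ⊔ G)
    (Submodule.add_mem_sup (add_mem hw' hw'') hg) (e' + a - (f' + b))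
  have h13 : ‖e' + a - (f' + b) - (w' + w'' + g)‖ ≤ M + 2 * (δ * K) + δ * (4 * K + 2 * M) := by
    rw [show e' + a - (f' + b) - (w' + w'' + g) = (e + a - (f + b) - (w + g)) - (e - e1)
      + (f - f1) - (w'' - w) by
      rw [show e' + a - (f' + b) - (w' + w'' + g) = (e' - f' - w') + (a - b - w'' - g) by abel,
        ← hdiff]
      abel]
    refine (norm_sub_le _ _).trans ?_
    have i1 := norm_add_le (e + a - (f + b) - (w + g) - (e - e1)) (f - f1)
    have i2 := norm_sub_le (e + a - (f + b) - (w + g)) (e - e1)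
    have i3 : δ * ‖w‖ ≤ δ * (4 * K + 2 * M) := by gcongr
    linarith
  refine h12.trans (h13.trans ?_)
  rw [← hηε]
  exact approx_arith hc hδ0 hδ1 hN0 hη.le hK hM

end

section
variable {X : Type*} [NormedAddCommGroup X] [NormedSpace ℝ X]

theorem exists_coloring (L : Submodule ℝ X) [FiniteDimensional ℝ L] {δ : ℝ} (hδ : 0 < δ) :
    ∃ χ : Submodule ℝ X → Set X, (Set.range χ).Finite ∧ ∀ S S' : Submodule ℝ X,
      S' ≤ L → χ S' = χ S → Approx δ S' S := by
  have hS : IsCompact (((↑) : L → X) '' Metric.sphere 0 1) :=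
    (isCompact_sphere _ _).image continuous_subtype_val
  obtain ⟨N, hNS, hN, hcov⟩ := hS.finite_cover_balls (half_pos hδ)
  refine ⟨fun S => {d ∈ N | ∃ s ∈ S, ‖s - d‖ ≤ δ / 2}, ?_, ?_⟩
  · refine hN.finite_subsets.subset ?_
    rintro _ ⟨S, rfl⟩
    exact fun d hd => hd.1
  · intro S S' hS' hχ s' hs'
    rcases eq_or_ne s' 0 with rfl | h0
    · exact ⟨0, S.zero_mem, by simp⟩
    have hpos : 0 < ‖s'‖ := norm_pos_iff.2 h0
    set a := ‖s'‖⁻¹ • s' with ha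
    have ha1 : ‖a‖ = 1 := by rw [ha, norm_smul]; simp [hpos.ne']
    have haS : a ∈ S' := S'.smul_mem _ hs'
    obtain ⟨d, hd, had⟩ : ∃ d ∈ N, a ∈ Metric.ball d (δ / 2) := by
      simpa using hcov ⟨⟨a, hS' haS⟩, by simpa using ha1, rfl⟩
    rw [mem_ball_iff_norm] at had
    have hdS' : d ∈ {d ∈ N | ∃ s ∈ S', ‖s - d‖ ≤ δ / 2} := ⟨hd, a, haS, had.le⟩
    obtain ⟨-, s, hs, hsd⟩ : d ∈ {d ∈ N | ∃ s ∈ S, ‖s - d‖ ≤ δ / 2} :=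
      (Set.ext_iff.1 hχ d).1 hdS'
    refine ⟨‖s'‖ • s, S.smul_mem _ hs, ?_⟩
    have h1 : ‖s'‖ • s - s' = ‖s'‖ • (s - a) := by
      rw [smul_sub, ha, smul_smul, mul_inv_cancel₀ hpos.ne', one_smul]
    have h2 : ‖s - a‖ ≤ δ := by
      have := norm_sub_le_norm_sub_add_norm_sub s d a
      rw [norm_sub_rev d a] at this
      linarith
    rw [h1, norm_smul, norm_norm, mul_comm]
    gcongr

variable {x : ℕ → X}

theorem exists_tri_coloring (hx : BK x) {c c' : ℝ} (hc : 1 ≤ c) (hc' : c < c') (m : ℕ) :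
    ∃ χ : Tri X → Set X × Set X × Set X, (Set.range χ).Finite ∧ ∀ t t' : Tri X,
      Adm x m t → Adm x m t' → χ t = χ t' → ∀ r r', Dec x c t r m → Dec x c t' r' m →
        Dec x c' t' r m := by
  have h38 : 0 < 38 * c ^ 2 := by positivity
  set δ := min 1 ((c' - c) / (38 * c ^ 2)) with hδ
  have hδ0 : 0 < δ := lt_min one_pos (div_pos (by linarith) h38)
  have hδ1 : δ ≤ 1 := min_le_left _ _
  have hδ2 : c + 38 * c ^ 2 * δ ≤ c' := by
    have : δ ≤ (c' - c) / (38 * c ^ 2) := min_le_right _ _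
    rw [le_div_iff₀ h38] at this
    linarith
  obtain ⟨χ, hχ, hap⟩ := exists_coloring (sp x 0 m) hδ0
  refine ⟨fun t => (χ t.E, χ t.F, χ t.W), ?_, ?_⟩
  · refine (hχ.prod (hχ.prod hχ)).subset ?_
    rintro _ ⟨t, rfl⟩
    exact ⟨⟨_, rfl⟩, ⟨_, rfl⟩, ⟨_, rfl⟩⟩
  · intro t t' ht hs h r r' ⟨u, v, hw⟩ hd
    simp only [Prod.mk.injEq] at h
    refine ⟨u, v, { hw with sep := IsSep.mono hδ2 ?_ }⟩
    exact IsSep.of_approx hx hc hδ0.le hδ1 ht hs (hap _ _ hs.E_le h.1.symm)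
      (hap _ _ hs.F_le h.2.1.symm) (hap _ _ (ht.WE.trans ht.E_le) h.2.2)
      (hw.hu.iSup_F_le_high hw.s_zero.ge)
      (hw.hv.iSup_F_le_high (by rw [← hw.s_eq]; exact hw.s_zero.ge))
      (hw.hu.iSup_G_le_high hw.s_zero.ge) hw.sep (hd.sep hx hs)

/-- At stage `k`, a decomposable triple stays decomposable below every further sequence. -/
def Stable (x : ℕ → X) (c : ℕ → ℝ) (p : ℕ → Blk X) (k : ℕ) : Prop :=
  ∀ t, Adm x (p k).s t → Dec x (c k) t p (p k).s →
    ∀ r, IsSeq x r → BLe r p → (r 0).s = (p k).s → Dec x (c (k + 1)) t r (p k).s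

theorem exists_refines_stable (hx : BK x) {c : ℕ → ℝ} (hc : ∀ k, 1 ≤ c k)
    (hc' : ∀ k, c k < c (k + 1)) {p : ℕ → Blk X} (hp : IsSeq x p) (k : ℕ) :
    ∃ p', Refines x k p' p ∧ Stable x c p' k := by
  obtain ⟨χ, hχ, hcol⟩ := exists_tri_coloring hx (hc k) (hc' k) (p k).s
  let A : Set X × Set X × Set X → (ℕ → Blk X) → Prop := fun κ r =>
    ∃ t, Adm x (p k).s t ∧ χ t = κ ∧ Dec x (c k) t r (p k).s
  have step : ∀ K : Finset (Set X × Set X × Set X), ∃ p', Refines x k p' p ∧ ∀ κ ∈ K,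
      ¬A κ p' ∨ ∀ r, IsSeq x r → BLe r p' → (r 0).s = (p k).s → A κ r := by
    classical
    intro K
    induction K using Finset.induction_on with
    | empty => exact ⟨p, .refl hp k, by simp⟩
    | insert κ K _ ih =>
      obtain ⟨p', hp', hK⟩ := ih
      by_cases h : ∀ r, IsSeq x r → BLe r p' → (r 0).s = (p k).s → A κ r
      · refine ⟨p', hp', fun κ' hκ' => ?_⟩
        rcases Finset.mem_insert.1 hκ' with rfl | h'
        · exact .inr h
        · exact hK _ h'
      · push Not at h
        obtain ⟨r, hr, hrp, hrs, hA⟩ := h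
        have href := refines_splice hp'.isSeq hr hrp (hrs.trans hp'.s_eq.symm)
        refine ⟨splice p' k r, href.trans hp' hp, fun κ' hκ' => ?_⟩
        rcases Finset.mem_insert.1 hκ' with rfl | h'
        · refine .inl fun ⟨t, ht, htκ, hd⟩ => hA ⟨t, ht, htκ, ?_⟩
          have := hd.tail href.isSeq (k := k) (by rw [href.s_eq, hp'.s_eq])
          rwa [splice_tail] at this
        · refine (hK _ h').imp (fun hn ⟨t, ht, htκ, hd⟩ => hn ⟨t, ht, htκ, ?_⟩)
            (fun hall r hr hrp => hall r hr (hrp.trans href.le href.isSeq hp'.isSeq))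
          exact hd.below href.isSeq hp'.isSeq href.le
  obtain ⟨p', hp', hK⟩ := step hχ.toFinset
  refine ⟨p', hp', fun t ht hd r hr hrp hrs => ?_⟩
  rw [hp'.s_eq] at ht hd hrs ⊢
  rcases hK (χ t) (by simp) with h | h
  · exact absurd ⟨t, ht, rfl, hd⟩ h
  · obtain ⟨t', ht', hχt, hd'⟩ := h r hr hrp hrs
    exact hcol t' t ht' ht hχt r p' hd' hd

theorem exists_stable (hx : BK x) {c : ℕ → ℝ} (hc : ∀ k, 1 ≤ c k)
    (hc' : ∀ k, c k < c (k + 1)) {p : ℕ → Blk X} (hp : IsSeq x p) :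
    ∃ p', IsSeq x p' ∧ BLe p' p ∧ (p' 0).s = (p 0).s ∧ ∀ k, Stable x c p' k := by
  refine fusion (Stable x c) (fun p hp k => exists_refines_stable hx hc hc' hp k) ?_ p hp
  intro p p' k hp hp' hst t ht hd r hr hrp hrs
  have hk := hp'.eq k (by omega)
  rw [hk] at ht hd hrs ⊢
  exact hst t ht (hd.below hp'.isSeq hp hp'.le) r hr (hrp.trans hp'.le hp'.isSeq hp) hrs

end

section
variable {X : Type*} [NormedAddCommGroup X] [NormedSpace ℝ X] {x : ℕ → X}

/-- Extension of a triple by a block: the numerator goes to the first summand, or to the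
second one. -/
def Tri.ext (t : Tri X) (z : Blk X) : Bool → Tri X
  | true => ⟨t.E ⊔ z.F, t.F ⊔ z.G, t.W ⊔ z.G⟩
  | false => ⟨t.E ⊔ z.G, t.F ⊔ z.F, t.W ⊔ z.G⟩

theorem Tri.swap_ext (t : Tri X) (z : Blk X) (b : Bool) : (t.ext z b).swap = t.swap.ext z (!b) := by
  cases b <;> rfl

theorem Adm.ext {t : Tri X} {z : Blk X} (ht : Adm x z.s t) (hzs : z.s ≤ z.t) (hz : z.G ≤ z.F)
    (hzF : z.F ≤ sp x z.s z.t) (b : Bool) : Adm x z.t (t.ext z b) := by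
  have h1 := ht.E_le.trans (sp_mono x le_rfl hzs)
  have h2 := ht.F_le.trans (sp_mono x le_rfl hzs)
  have h3 : z.F ≤ sp x 0 z.t := hzF.trans (sp_mono x (Nat.zero_le _) le_rfl)
  cases b
  · exact ⟨sup_le_sup ht.WE le_rfl, sup_le_sup ht.WF hz, sup_le h1 (hz.trans h3), sup_le h2 h3⟩
  · exact ⟨sup_le_sup ht.WE hz, sup_le_sup ht.WF le_rfl, sup_le h1 h3, sup_le h2 (hz.trans h3)⟩

theorem Dec.ext {C : ℝ} {t : Tri X} {p q u v : ℕ → Blk X} {m : ℕ}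
    (h : Wit x C t p m u v) (hq : BLe q u) (hq0 : (q 0).s = m) :
    Dec x C (t.ext (q 0) true) p (q 0).t := by
  obtain ⟨a, ha⟩ := (hq 0).t_eq
  set z := q 0 with hz
  have hsmall : ∀ i, (u i).t ≤ z.t ↔ i < a := by
    intro i
    rw [ha, h.hu.t_eq, h.hu.s_le_iff]; rfl
  have hGz : ∀ i < a, (u i).G ≤ z.G := fun i hi =>
    (hq 0).G_le i (by rw [← hz, hq0, ← h.s_zero]; exact h.hu.s_le_iff.2 (Nat.zero_le i))
      ((hsmall i).2 hi)
  have hzF : z.F ≤ ⨆ n, (u n).F := (hq 0).F_le.trans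
    (iSup₂_le fun i _ => le_iSup (fun n => (u n).F) i)
  have hzG : z.G ≤ ⨆ n, (u n).F := (hq 0).G_lt.le.trans hzF
  have hut : ⨆ n, (u (n + a)).F ≤ ⨆ n, (u n).F :=
    iSup_le fun n => le_iSup (fun n => (u n).F) (n + a)
  have hvt : ⨆ n, (v (n + a)).F ≤ ⨆ n, (v n).F :=
    iSup_le fun n => le_iSup (fun n => (v n).F) (n + a)
  refine ⟨fun n => u (n + a), fun n => v (n + a), h.hu.tail a, h.hv.tail a, h.ur.tail a,
    h.vr.tail a, by simp [ha], fun n => h.s_eq _, fun n => h.G_eq _, ?_⟩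
  have hW : t.W ⊔ ⨆ n, (u n).G ≤ t.W ⊔ z.G ⊔ ⨆ n, (u (n + a)).G := by
    refine sup_le (le_sup_of_le_left le_sup_left) (iSup_le fun i => ?_)
    rcases lt_or_ge i a with hi | hi
    · exact (hGz i hi).trans (le_sup_of_le_left le_sup_right)
    · obtain ⟨j, rfl⟩ := Nat.exists_eq_add_of_le' hi
      exact le_sup_of_le_right (le_iSup (fun n => (u (n + a)).G) j)
  intro y hy w hw
  have hy' : y ∈ t.E ⊔ ⨆ n, (u n).F :=
    (sup_le (sup_le le_sup_left (hzF.trans le_sup_right)) (hut.trans le_sup_right) :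
      t.E ⊔ z.F ⊔ ⨆ n, (u (n + a)).F ≤ _) hy
  have hw' : w ∈ (t.F ⊔ ⨆ n, (v n).F) ⊔ z.G :=
    (sup_le (sup_le (le_sup_of_le_left le_sup_left) le_sup_right)
      (le_sup_of_le_left (hvt.trans le_sup_right)) : t.F ⊔ z.G ⊔ ⨆ n, (v (n + a)).F ≤ _) hw
  obtain ⟨w, hw0, g, hg, rfl⟩ := Submodule.mem_sup.1 hw'
  have hgW : g ∈ t.W ⊔ z.G ⊔ ⨆ n, (u (n + a)).G :=
    (le_sup_of_le_left le_sup_right : z.G ≤ _) hg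
  have hyg : y + g ∈ t.E ⊔ ⨆ n, (u n).F :=
    add_mem hy' ((hzG.trans le_sup_right : z.G ≤ t.E ⊔ ⨆ n, (u n).F) hg)
  have h1 := h.sep _ hyg w hw0
  have h2 := infDist_anti hW (y + g - w)
  have h3 := infDist_add_mem (add_mem hgW hgW) (y - (w + g))
  rw [show y - (w + g) + (g + g) = y + g - w by abel] at h3
  rw [show y + g + w = y + (w + g) by abel] at h1
  exact h3.symm.le.trans (h2.trans h1)

/-- A finite set of triples all of which stay decomposable below every sequence. -/
structure GoodSet (x : ℕ → X) (c : ℕ → ℝ) (p : ℕ → Blk X) (T : Set (Tri X)) (k : ℕ) : Prop where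
  fin : T.Finite
  swap : ∀ t ∈ T, t.swap ∈ T
  adm : ∀ t ∈ T, Adm x (p k).s t
  dec : ∀ t ∈ T, ∀ r, IsSeq x r → BLe r p → (r 0).s = (p k).s → Dec x (c (k + 1)) t r (p k).s

theorem GoodSet.step {c : ℕ → ℝ} (hc : ∀ k, c k < c (k + 1)) {p : ℕ → Blk X} (hp : IsSeq x p)
    (hst : ∀ k, Stable x c p k) {T : Set (Tri X)} {k : ℕ} (hT : GoodSet x c p T k) :
    ∃ (z : Blk X) (k' : ℕ), z.s = (p k).s ∧ z.t = (p k').s ∧ z.s < z.t ∧ z.G < z.F ∧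
      z.F ≤ sp x z.s z.t ∧
      GoodSet x c p (Set.image2 (fun t b => t.ext z b) T Set.univ) k' := by
  have hq : ∃ q, IsSeq x q ∧ BLe q p ∧ (q 0).s = (p k).s ∧ ∀ t ∈ T, ∃ u v,
      Wit x (c (k + 1)) t p (p k).s u v ∧ BLe q u := by
    refine Set.Finite.induction_on_subset (motive := fun S _ => ∃ q, IsSeq x q ∧ BLe q p ∧
      (q 0).s = (p k).s ∧ ∀ t ∈ S, ∃ u v, Wit x (c (k + 1)) t p (p k).s u v ∧ BLe q u) T hT.fin
      ⟨fun n => p (n + k), hp.tail k, hp.refl.tail k, by simp, by simp⟩ ?_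
    rintro t S ht - - ⟨q, hq, hqp, hqs, hS⟩
    obtain ⟨u, v, h⟩ := hT.dec t ht q hq hqp hqs
    have h' := h.below hq hp hqp
    refine ⟨u, h.hu, h'.ur, h.s_zero, fun t' ht' => ?_⟩
    rcases Set.mem_insert_iff.1 ht' with rfl | ht'
    · exact ⟨u, v, h', h.hu.refl⟩
    · obtain ⟨u', v', hw, hqu⟩ := hS t' ht'
      exact ⟨u', v', hw, h.ur.trans hqu hq hw.hu⟩
  obtain ⟨q, hq, hqp, hqs, hqT⟩ := hq
  obtain ⟨k', hk'⟩ := (hqp 0).t_eq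
  have hkk' : k < k' := by
    have := (hq 0).1
    rw [hk', hqs] at this
    exact hp.s_lt_iff.1 this
  have hcm : StrictMono c := strictMono_nat_of_lt_succ hc
  have hadm : ∀ t ∈ T, ∀ b, Adm x (p k').s (t.ext (q 0) b) := by
    intro t ht b
    rw [← hk']
    refine Adm.ext ?_ (hq 0).1.le (hq.G_le_F 0) (hq 0).2.2.2 b
    rw [hqs]; exact hT.adm t ht
  have hdec : ∀ t ∈ T, Dec x (c k') (t.ext (q 0) true) p (p k').s := by
    intro t ht
    obtain ⟨u, v, hw, hqu⟩ := hqT t ht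
    rw [← hk']
    exact (Dec.ext hw hqu hqs).mono (hcm.monotone hkk')
  refine ⟨q 0, k', hqs, hk', (hq 0).1, (hq 0).2.2.1, (hq 0).2.2.2, ?_, ?_, ?_, ?_⟩
  · exact hT.fin.image2 _ Set.finite_univ
  · rintro _ ⟨t, ht, b, -, rfl⟩
    exact ⟨t.swap, hT.swap t ht, !b, trivial, (t.swap_ext (q 0) b).symm⟩
  · rintro _ ⟨t, ht, b, -, rfl⟩
    exact hadm t ht b
  · rintro _ ⟨t, ht, b, -, rfl⟩
    refine hst k' _ (hadm t ht b) ?_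
    cases b
    · have := (hdec _ (hT.swap t ht)).swap
      rwa [Tri.swap_ext] at this
    · exact hdec t ht

/-- The triple generated by the first `n` blocks of `z` according to the choices `σ`. -/
def Tri.gen (z : ℕ → Blk X) (σ : ℕ → Bool) : ℕ → Tri X
  | 0 => ⟨⊥, ⊥, ⊥⟩
  | n + 1 => (Tri.gen z σ n).ext (z n) (σ n)

theorem exists_unconditional_blocks (hx : BK x) {C : ℝ} (hC : 1 ≤ C) {p : ℕ → Blk X}
    (hp : IsSeq x p) (h : ∀ r, IsSeq x r → BLe r p → (r 0).s = (p 0).s →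
      Dec x C ⟨⊥, ⊥, ⊥⟩ r (p 0).s) :
    ∃ z, IsSeq x z ∧ ∀ σ n, IsSep (2 * (C + 1)) (Tri.gen z σ n).E (Tri.gen z σ n).F
      (Tri.gen z σ n).W := by
  let c : ℕ → ℝ := fun k => C + 1 - (1 / 2) ^ k
  have hc1 : ∀ k, C ≤ c k := fun k => by
    have : (1 / 2 : ℝ) ^ k ≤ 1 := pow_le_one₀ (by norm_num) (by norm_num)
    simp only [c]; linarith
  have hc2 : ∀ k, c k ≤ C + 1 := fun k => by
    have : (0 : ℝ) ≤ (1 / 2 : ℝ) ^ k := by positivity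
    simp only [c]; linarith
  have hc : ∀ k, c k < c (k + 1) := fun k => by
    have : (0 : ℝ) < (1 / 2 : ℝ) ^ k := by positivity
    simp only [c, pow_succ]; linarith
  obtain ⟨q, hq, hqp, hq0, hst⟩ := exists_stable hx (fun k => hC.trans (hc1 k)) hc hp
  have h0 : GoodSet x c q {⟨⊥, ⊥, ⊥⟩} 0 := by
    refine ⟨Set.finite_singleton _, ?_, ?_, ?_⟩
    · rintro _ rfl; rfl
    · rintro _ rfl; exact ⟨le_rfl, le_rfl, bot_le, bot_le⟩
    · rintro _ rfl r hr hrq hrs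
      rw [hq0] at hrs ⊢
      exact (h r hr (hrq.trans hqp hq hp) hrs).mono (hc1 _)
  choose Z K hZ1 hZ2 hZ3 hZ4 hZ5 hZ6 using
    fun s : {s : Set (Tri X) × ℕ // GoodSet x c q s.1 s.2} => s.2.step hc hq hst
  let S : ℕ → {s : Set (Tri X) × ℕ // GoodSet x c q s.1 s.2} := fun n =>
    Nat.rec ⟨(_, _), h0⟩ (fun _ s => ⟨(_, _), hZ6 s⟩) n
  refine ⟨fun n => Z (S n), fun n => ⟨hZ3 _, ?_, hZ4 _, hZ5 _⟩, fun σ n => ?_⟩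
  · rw [hZ2, hZ1]
  have hmem : ∀ n, Tri.gen (fun n => Z (S n)) σ n ∈ (S n).1.1 := by
    intro n
    induction n with
    | zero => exact Set.mem_singleton _
    | succ n ih => exact ⟨_, ih, σ n, trivial, rfl⟩
  have hd := (S n).2.dec _ (hmem n) (fun i => q (i + (S n).1.2)) (hq.tail _) (hq.refl.tail _)
    (by simp)
  exact (hd.sep hx ((S n).2.adm _ (hmem n))).mono (by linarith [hc2 ((S n).1.2 + 1)])

end

section
variable {X : Type*} [AddCommGroup X] [Module ℝ X]

/-- Sum of the first `n` subspaces. -/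
def lo (F : ℕ → Submodule ℝ X) (n : ℕ) : Submodule ℝ X := ⨆ i, ⨆ _ : i < n, F i

/-- Sum of all subspaces from the `n`-th on. -/
def hi (F : ℕ → Submodule ℝ X) (n : ℕ) : Submodule ℝ X := ⨆ i, ⨆ _ : n ≤ i, F i

variable {F G : ℕ → Submodule ℝ X}

theorem le_lo {i n : ℕ} (h : i < n) : F i ≤ lo F n := le_iSup₂_of_le i h le_rfl

theorem le_hi {i n : ℕ} (h : n ≤ i) : F i ≤ hi F n := le_iSup₂_of_le i h le_rfl

theorem lo_mono : Monotone (lo F) := fun _ _ h => iSup₂_le fun _ hi => le_lo (hi.trans_le h)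

theorem hi_anti : Antitone (hi F) := fun _ _ h => iSup₂_le fun _ hi => le_hi (h.trans hi)

theorem lo_le_iSup (n : ℕ) : lo F n ≤ ⨆ i, F i := iSup₂_le fun i _ => le_iSup F i

theorem hi_le_iSup (n : ℕ) : hi F n ≤ ⨆ i, F i := iSup₂_le fun i _ => le_iSup F i

theorem lo_sup_hi (n : ℕ) : lo F n ⊔ hi F n = ⨆ i, F i := by
  refine le_antisymm (sup_le (lo_le_iSup n) (hi_le_iSup n)) (iSup_le fun i => ?_)
  rcases lt_or_ge i n with h | h
  · exact (le_lo h).trans le_sup_left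
  · exact (le_hi h).trans le_sup_right

theorem lo_zero : lo F 0 = ⊥ := by simp [lo]

theorem lo_succ (n : ℕ) : lo F (n + 1) = lo F n ⊔ F n := by
  refine le_antisymm (iSup₂_le fun i hi => ?_) (sup_le (lo_mono n.le_succ) (le_lo n.lt_succ_self))
  rcases Nat.lt_succ_iff_lt_or_eq.1 hi with h | rfl
  · exact (le_lo h).trans le_sup_left
  · exact le_sup_right

theorem exists_mem_lo {y : X} (hy : y ∈ ⨆ i, F i) : ∃ n, y ∈ lo F n := by
  have : ⨆ i, F i = ⨆ n, lo F n :=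
    le_antisymm (iSup_le fun i => le_iSup_of_le (i + 1) (le_lo i.lt_succ_self))
      (iSup_le lo_le_iSup)
  rwa [this, Submodule.mem_iSup_of_directed _ lo_mono.directed_le] at hy

theorem iSup_mono_lo (h : ∀ n, G n ≤ F n) (n : ℕ) : lo G n ≤ lo F n := iSup₂_mono fun i _ => h i

theorem iSup_mono_hi (h : ∀ n, G n ≤ F n) (n : ℕ) : hi G n ≤ hi F n := iSup₂_mono fun i _ => h i

theorem sum_mem_lo {f : ℕ → X} (hf : ∀ n, f n ∈ F n) (n : ℕ) :
    ∑ i ∈ Finset.range n, f i ∈ lo F n :=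
  sum_mem fun i hi => le_lo (Finset.mem_range.1 hi) (hf i)

theorem sum_mem_hi {f : ℕ → X} (hf : ∀ n, f n ∈ F n) (m n : ℕ) :
    ∑ i ∈ Finset.Ico m n, f i ∈ hi F m :=
  sum_mem fun i hi => le_hi (Finset.mem_Ico.1 hi).1 (hf i)

/-- Pairs of subspaces `G n ≤ F n` supported on successive intervals. -/
structure IsBlocks (x : ℕ → X) (s : ℕ → ℕ) (F G : ℕ → Submodule ℝ X) : Prop where
  mono : Monotone s
  le : ∀ n, G n ≤ F n
  F_le : ∀ n, F n ≤ sp x (s n) (s (n + 1))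

variable {x : ℕ → X} {s : ℕ → ℕ}

theorem IsSeq.isBlocks {p : ℕ → Blk X} (hp : IsSeq x p) :
    IsBlocks x (fun n => (p n).s) (fun n => (p n).F) fun n => (p n).G :=
  ⟨hp.strictMono.monotone, hp.G_le_F, fun n => by rw [← hp.t_eq]; exact (hp n).2.2.2⟩

theorem IsBlocks.lo_le (h : IsBlocks x s F G) (n : ℕ) : lo F n ≤ sp x 0 (s n) :=
  iSup₂_le fun i hi => (h.F_le i).trans (sp_mono x (Nat.zero_le _) (h.mono hi))

theorem IsBlocks.hi_le (h : IsBlocks x s F G) (n : ℕ) : hi F n ≤ high x (s n) :=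
  iSup₂_le fun _ hi => (h.F_le _).trans (sp_le_high x (h.mono hi))

theorem IsBlocks.finite_lo (h : IsBlocks x s F G) (n : ℕ) : FiniteDimensional ℝ (lo F n) :=
  Submodule.finiteDimensional_of_le (h.lo_le n)

theorem IsBlocks.finite (h : IsBlocks x s F G) (n : ℕ) : FiniteDimensional ℝ (F n) :=
  Submodule.finiteDimensional_of_le (h.F_le n)

end

section
variable {X : Type*} [NormedAddCommGroup X] [NormedSpace ℝ X] {x : ℕ → X} {s : ℕ → ℕ}
  {F G : ℕ → Submodule ℝ X}

theorem IsBlocks.infDist_lo_le (h : IsBlocks x s F G) (hx : BK x) {n : ℕ} {y τ : X}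
    (hy : y ∈ lo F n) (hτ : τ ∈ hi F n) :
    Metric.infDist y (lo G n) ≤ 2 * Metric.infDist (y + τ) (⨆ i, G i : Submodule ℝ X) := by
  have := hx.infDist_le ((iSup_mono_lo h.le n).trans (h.lo_le n))
    ((iSup_mono_hi h.le n).trans (h.hi_le n)) (h.lo_le n hy) (h.hi_le n hτ)
  rwa [lo_sup_hi] at this

theorem IsBlocks.infDist_le (h : IsBlocks x s F G) (hx : BK x) {n : ℕ} {y τ : X}
    (hy : y ∈ lo F n) (hτ : τ ∈ hi F n) :
    Metric.infDist y (⨆ i, G i : Submodule ℝ X)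
      ≤ 2 * Metric.infDist (y + τ) (⨆ i, G i : Submodule ℝ X) :=
  (infDist_anti (lo_le_iSup n) y).trans (h.infDist_lo_le hx hy hτ)

/-- The map `φ` realizes a dense image of `⨆ F` normed by the distance to `⨆ G`. -/
structure IsRep {X Y : Type*} [SeminormedAddCommGroup X] [NormedSpace ℝ X]
    [SeminormedAddCommGroup Y] [NormedSpace ℝ Y] (φ : X →ₗ[ℝ] Y) (S T : Submodule ℝ X) :
    Prop where
  norm_eq : ∀ a ∈ S, ‖φ a‖ = Metric.infDist a T
  dense : ∀ y ε, 0 < ε → ∃ a ∈ S, ‖y - φ a‖ < ε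

theorem exists_isRep {Y : Type*} [SeminormedAddCommGroup Y] [NormedSpace ℝ Y]
    {S T : Submodule ℝ Y} (hTS : T ≤ S) :
    ∃ ψ : Y →ₗ[ℝ] ↥S.topologicalClosure ⧸ T.topologicalClosure.comap S.topologicalClosure.subtype,
      IsRep ψ S T := by
  set N := T.topologicalClosure.comap S.topologicalClosure.subtype with hN
  obtain ⟨ψ, hψ⟩ := LinearMap.exists_extend
    (N.mkQ ∘ₗ Submodule.inclusion S.le_topologicalClosure)
  have hψ' : ∀ y (hy : y ∈ S), ψ y = N.mkQ ⟨y, S.le_topologicalClosure hy⟩ := fun y hy =>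
    LinearMap.congr_fun hψ ⟨y, hy⟩
  refine ⟨ψ, fun a ha => ?_, fun y ε hε => ?_⟩
  · rw [hψ' a ha]
    have h1 : ‖N.mkQ ⟨a, S.le_topologicalClosure ha⟩‖ =
        Metric.infDist (⟨a, S.le_topologicalClosure ha⟩ : S.topologicalClosure) N :=
      QuotientAddGroup.norm_mk _
    rw [h1, ← Metric.infDist_image isometry_subtype_coe,
      ← Metric.infDist_closure (s := (T : Set Y)),
      ← Submodule.topologicalClosure_coe]
    congr 1
    ext w
    constructor
    · rintro ⟨w, hw, rfl⟩; exact hw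
    · intro hw
      exact ⟨⟨w, Submodule.topologicalClosure_mono hTS hw⟩, hw, rfl⟩
  · obtain ⟨z, rfl⟩ := N.mkQ_surjective y
    obtain ⟨a, ha, hza⟩ := Metric.mem_closure_iff.1 z.2 ε hε
    refine ⟨a, ha, ?_⟩
    rw [hψ' a ha, ← map_sub]
    refine (Submodule.Quotient.norm_mk_le N _).trans_lt ?_
    rw [dist_eq_norm] at hza
    exact hza

theorem eq_zero_of_norm_eq_zero {Y : Type*} [SeminormedAddCommGroup Y] [T2Space Y] {y : Y}
    (h : ‖y‖ = 0) : y = 0 := by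
  refine Inseparable.eq (Metric.inseparable_iff.2 ?_)
  rwa [dist_zero_right]

variable {Y : Type*} [SeminormedAddCommGroup Y] [NormedSpace ℝ Y] {φ : X →ₗ[ℝ] Y}

theorem IsBlocks.norm_le (h : IsBlocks x s F G) (hx : BK x)
    (hφ : IsRep φ (⨆ n, F n) (⨆ n, G n)) {n : ℕ} {y τ : X}
    (hy : y ∈ lo F n) (hτ : τ ∈ hi F n) : ‖φ y‖ ≤ 2 * ‖φ (y + τ)‖ := by
  rw [hφ.norm_eq y (lo_le_iSup n hy), hφ.norm_eq _
    (add_mem (lo_le_iSup n hy) (hi_le_iSup n hτ))]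
  exact h.infDist_le hx hy hτ

theorem IsBlocks.mem_of_map_eq_zero (h : IsBlocks x s F G) (hx : BK x)
    (hφ : IsRep φ (⨆ n, F n) (⨆ n, G n)) {n : ℕ} {f : X} (hf : f ∈ F n) (h0 : φ f = 0) :
    f ∈ G n := by
  have h1 : Metric.infDist f (⨆ n, G n : Submodule ℝ X) = 0 := by
    rw [← hφ.norm_eq f (le_iSup F n hf), h0, norm_zero]
  have h2 := h.infDist_lo_le hx (le_lo n.lt_succ_self hf) (zero_mem _)
  rw [add_zero, h1, mul_zero] at h2
  have h3 : FiniteDimensional ℝ (lo G (n + 1)) :=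
    have := h.finite_lo (n + 1)
    Submodule.finiteDimensional_of_le (iSup_mono_lo h.le _)
  have h4 : f ∈ lo G (n + 1) := by
    have h5 := Submodule.closed_of_finiteDimensional (lo G (n + 1))
    exact (h5.mem_iff_infDist_zero ⟨0, zero_mem _⟩).2 (le_antisymm h2 Metric.infDist_nonneg)
  rw [lo_succ] at h4
  obtain ⟨g', hg', g, hg, rfl⟩ := Submodule.mem_sup.1 h4
  have h5 : g' ∈ sp x 0 (s n) := h.lo_le n (iSup_mono_lo h.le n hg')
  have h6 : g' ∈ high x (s n) := by
    have : g' = g' + g - g := by abel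
    rw [this]
    exact h.hi_le n (sub_mem (le_hi le_rfl hf) (le_hi le_rfl (h.le n hg)))
  rw [(Submodule.disjoint_def.1 (hx.disjoint (s n))) g' h5 h6, zero_add]
  exact hg

variable [T2Space Y]

theorem eq_zero_of_tendsto_sum (hx : BK x) (h : IsBlocks x s F G)
    (hφ : IsRep φ (⨆ n, F n) (⨆ n, G n)) {d : ℕ → Y} (hd : ∀ n, d n ∈ (F n).map φ)
    (hlim : Tendsto (fun N => ∑ n ∈ Finset.range N, d n) atTop (𝓝 0)) : ∀ n, d n = 0 := by
  choose f hf hfd using hd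
  have key : ∀ n, ∑ i ∈ Finset.range n, d i = 0 := by
    intro n
    refine eq_zero_of_norm_eq_zero (le_antisymm ?_ (norm_nonneg _))
    have h1 : Tendsto (fun N => 2 * ‖∑ n ∈ Finset.range N, d n‖) atTop (𝓝 (2 * 0)) := by
      simpa using (hlim.norm.const_mul 2)
    rw [mul_zero] at h1
    refine ge_of_tendsto h1 (eventually_atTop.2 ⟨n, fun N hN => ?_⟩)
    have h2 := h.norm_le hx hφ (sum_mem_lo hf n) (sum_mem_hi hf n N)
    rw [Finset.sum_range_add_sum_Ico _ hN] at h2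
    simpa [map_sum, hfd] using h2
  intro n
  have := key (n + 1)
  rwa [Finset.sum_range_succ, key n, zero_add] at this

variable [CompleteSpace Y]

theorem exists_expansion (hx : BK x) (h : IsBlocks x s F G)
    (hφ : IsRep φ (⨆ n, F n) (⨆ n, G n)) (y : Y) :
    ∃ b : ℕ → Y, (∀ n, b n ∈ (F n).map φ) ∧
      Tendsto (fun N => ∑ n ∈ Finset.range N, b n) atTop (𝓝 y) := by
  choose Q hQ1 hQ2 using fun n => hx.exists_proj (s n)
  have hQlo : ∀ n, ∀ a ∈ lo F n, Q n a = a := fun n a ha => hQ1 n a (h.lo_le n ha)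
  have hQhi : ∀ n, ∀ a ∈ hi F n, Q n a = 0 := fun n a ha => hQ2 n a (h.hi_le n ha)
  have hQm : ∀ n, ∀ a ∈ ⨆ n, F n, Q n a ∈ lo F n ∧ a - Q n a ∈ hi F n := by
    intro n a ha
    rw [← lo_sup_hi n] at ha
    obtain ⟨b, hb, c, hc, rfl⟩ := Submodule.mem_sup.1 ha
    rw [map_add, hQlo n b hb, hQhi n c hc]
    simpa using ⟨hb, hc⟩
  have hQn : ∀ n, ∀ a ∈ ⨆ n, F n, ‖φ (Q n a)‖ ≤ 2 * ‖φ a‖ := by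
    intro n a ha
    have := h.norm_le hx hφ (hQm n a ha).1 (hQm n a ha).2
    rwa [add_sub_cancel] at this
  have hQF : ∀ n, ∀ a ∈ ⨆ n, F n, Q (n + 1) a - Q n a ∈ F n := by
    intro n a ha
    have ha' := ha
    rw [← lo_sup_hi (n + 1)] at ha
    obtain ⟨b, hb, c, hc, rfl⟩ := Submodule.mem_sup.1 ha
    rw [map_add, map_add, hQlo _ b hb, hQhi _ c hc, hQhi n c (hi_anti n.le_succ hc)]
    rw [lo_succ] at hb
    obtain ⟨b', hb', f, hf, rfl⟩ := Submodule.mem_sup.1 hb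
    rw [map_add, hQlo n b' hb', hQhi n f (le_hi le_rfl hf)]
    simpa using hf
  choose a haS hay using fun k : ℕ => hφ.dense y (1 / ((k : ℝ) + 1)) (by positivity)
  have hlim : Tendsto (fun k => φ (a k)) atTop (𝓝 y) := by
    rw [tendsto_iff_norm_sub_tendsto_zero]
    refine squeeze_zero (fun _ => norm_nonneg _) (fun k => ?_)
      tendsto_one_div_add_atTop_nhds_zero_nat
    rw [norm_sub_rev]
    exact (hay k).le
  have hcau : ∀ n, CauchySeq fun k => φ (Q n (a k)) := by
    intro n
    refine Metric.cauchySeq_iff'.2 fun ε hε => ?_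
    obtain ⟨N, hN⟩ := Metric.cauchySeq_iff'.1 hlim.cauchySeq (ε / 2) (half_pos hε)
    refine ⟨N, fun k hk => ?_⟩
    have h1 := hN k hk
    rw [dist_eq_norm, ← map_sub] at h1 ⊢
    rw [← map_sub]
    have := hQn n _ (sub_mem (haS k) (haS N))
    linarith
  choose S hS using fun n => cauchySeq_tendsto_of_complete (hcau n)
  have hSn : ∀ n k, ‖S n - φ (Q n (a k))‖ ≤ 2 * ‖y - φ (a k)‖ := by
    intro n k
    refine le_of_tendsto_of_tendsto' ((hS n).sub_const _).norm
      ((hlim.sub_const (φ (a k))).norm.const_mul 2) fun j => ?_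
    rw [← map_sub, ← map_sub, ← map_sub]
    exact hQn n _ (sub_mem (haS j) (haS k))
  have hS0 : S 0 = 0 := by
    refine tendsto_nhds_unique (hS 0) ?_
    have : ∀ k, φ (Q 0 (a k)) = 0 := fun k => by
      have := (hQm 0 (a k) (haS k)).1
      rw [lo_zero, Submodule.mem_bot] at this
      rw [this, map_zero]
    simp [this]
  refine ⟨fun n => S (n + 1) - S n, fun n => ?_, ?_⟩
  · have := h.finite n
    have hcl : IsClosed (((F n).map φ : Submodule ℝ Y) : Set Y) :=
      Submodule.closed_of_finiteDimensional _
    refine hcl.mem_of_tendsto ((hS (n + 1)).sub (hS n)) (Eventually.of_forall fun k => ?_)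
    rw [← map_sub]
    exact Submodule.mem_map_of_mem (hQF n _ (haS k))
  · simp only [Finset.sum_range_sub, hS0, sub_zero]
    rw [Metric.tendsto_atTop]
    intro ε hε
    obtain ⟨k, hk⟩ := exists_nat_one_div_lt (show 0 < ε / 4 by linarith)
    obtain ⟨N, hN⟩ := exists_mem_lo (haS k)
    refine ⟨N, fun n hn => ?_⟩
    have h1 := hSn n k
    rw [hQlo n (a k) (lo_mono hn hN)] at h1
    have h2 := hay k
    rw [dist_eq_norm]
    have := norm_sub_le_norm_sub_add_norm_sub (S n) (φ (a k)) y
    rw [norm_sub_rev (φ (a k)) y] at this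
    linarith

theorem IsSeq.isFDD {p : ℕ → Blk X} (hx : BK x) (hp : IsSeq x p)
    (hφ : IsRep φ (⨆ n, (p n).F) (⨆ n, (p n).G)) : IsFDD fun n => (p n).F.map φ := by
  refine ⟨fun n hn => ?_, fun n => ?_, fun y => ?_⟩
  · obtain ⟨f, hf, hfG⟩ := SetLike.exists_of_lt (hp n).2.2.1
    refine hfG (hp.isBlocks.mem_of_map_eq_zero hx hφ hf ?_)
    have := Submodule.mem_map_of_mem (f := φ) hf
    rwa [show (p n).F.map φ = ⊥ from hn, Submodule.mem_bot] at this
  · have := hp.isBlocks.finite n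
    infer_instance
  · obtain ⟨b, hb, hlim⟩ := exists_expansion hx hp.isBlocks hφ y
    refine ⟨fun n => ⟨b n, hb n⟩, hlim, fun b' hb' => ?_⟩
    have := eq_zero_of_tendsto_sum hx hp.isBlocks hφ (d := fun n => (b' n : Y) - b n)
      (fun n => sub_mem (b' n).2 (hb n)) (by simpa using hb'.sub hlim)
    funext n
    exact Subtype.ext (sub_eq_zero.1 (this n))

end

theorem IsFDD.not_finiteDimensional {Y : Type*} [SeminormedAddCommGroup Y] [NormedSpace ℝ Y]
    {B : ℕ → Submodule ℝ Y} (hB : IsFDD B) : ¬FiniteDimensional ℝ Y := by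
  intro hfin
  choose v hv hv0 using fun n => (Submodule.ne_bot_iff _).1 (hB.1 n)
  have hli : LinearIndependent ℝ v := by
    rw [linearIndependent_iff']
    intro s g hg i hi
    have key : ∀ N, s ⊆ Finset.range N →
        ∑ n ∈ Finset.range N, (if n ∈ s then g n • v n else 0) = 0 := by
      intro N hN
      rw [← Finset.sum_filter, Finset.filter_mem_eq_inter, Finset.inter_eq_right.2 hN, hg]
    obtain ⟨N₀, hN₀⟩ := s.exists_nat_subset_range
    have h1 := (hB.2.2 0).unique (y₁ := fun n => ⟨if n ∈ s then g n • v n else 0, by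
      split_ifs
      · exact (B n).smul_mem _ (hv n)
      · exact zero_mem _⟩) (y₂ := fun n => 0)
      (tendsto_atTop_of_eventually_const (i₀ := N₀) fun N hN =>
        key N (hN₀.trans (Finset.range_mono hN))) (by simpa using tendsto_const_nhds)
    have h2 := congrArg Subtype.val (congrFun h1 i)
    simp only [hi, if_true, ZeroMemClass.coe_zero] at h2
    exact (smul_eq_zero.1 h2).resolve_right (hv0 i)
  have := hli.finite
  exact not_finite ℕ

section
variable {Y : Type*} [SeminormedAddCommGroup Y] [NormedSpace ℝ Y] {e : ℕ → Y}

theorem IsFDD.isSchauderBasis (h : IsFDD fun n => Submodule.span ℝ {e n}) : IsSchauderBasis e := by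
  have he : ∀ n, e n ≠ 0 := fun n h0 => h.1 n (by simp [h0])
  intro y
  obtain ⟨b, hb, hu⟩ := h.2.2 y
  choose c hc using fun n => Submodule.mem_span_singleton.1 (b n).2
  refine ⟨c, by simpa only [hc] using hb, fun c' hc' => ?_⟩
  have := hu (fun n => ⟨c' n • e n, Submodule.smul_mem _ _ (Submodule.mem_span_singleton_self _)⟩)
    hc'
  funext n
  have h2 := congrArg Subtype.val (congrFun this n)
  rw [← hc] at h2
  exact smul_left_injective ℝ (he n) h2

theorem IsSchauderBasis.isUnconditional [CompleteSpace Y] (h : IsSchauderBasis e) {K : ℝ}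
    (hK : 1 ≤ K) (hb : ∀ ε : ℕ → ℝ, (∀ n, ε n = 1 ∨ ε n = -1) → ∀ (c : ℕ → ℝ) (N : ℕ),
      ‖∑ n ∈ Finset.range N, (ε n * c n) • e n‖ ≤ K * ‖∑ n ∈ Finset.range N, c n • e n‖) :
    IsUnconditionalSchauderBasis K e := by
  refine ⟨h, hK, fun c y hy ε hε => ?_⟩
  have hcau : CauchySeq fun N => ∑ n ∈ Finset.range N, (ε n * c n) • e n := by
    refine Metric.cauchySeq_iff'.2 fun δ hδ => ?_
    obtain ⟨N, hN⟩ := Metric.cauchySeq_iff'.1 hy.cauchySeq (δ / K) (by positivity)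
    refine ⟨N, fun n hn => ?_⟩
    have h1 := hN n hn
    rw [dist_eq_norm, ← Finset.sum_Ico_eq_sub _ hn] at h1 ⊢
    have h2 := hb ε hε (fun i => if N ≤ i then c i else 0) n
    have h3 : ∀ f : ℕ → Y, ∑ i ∈ Finset.range n, (if N ≤ i then f i else 0)
        = ∑ i ∈ Finset.Ico N n, f i := by
      intro f
      rw [← Finset.sum_filter]
      refine Finset.sum_congr ?_ fun _ _ => rfl
      ext i; simp [and_comm]
    simp only [mul_ite, mul_zero, ite_smul, zero_smul, h3] at h2
    rw [lt_div_iff₀ (by linarith)] at h1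
    linarith
  obtain ⟨w, hw⟩ := cauchySeq_tendsto_of_complete hcau
  exact ⟨w, hw, le_of_tendsto_of_tendsto' hw.norm (hy.norm.const_mul K) (hb ε hε c)⟩

end

section
variable {X : Type*} [NormedAddCommGroup X] [NormedSpace ℝ X] {x : ℕ → X}

theorem Tri.gen_W (z : ℕ → Blk X) (σ : ℕ → Bool) (n : ℕ) :
    (Tri.gen z σ n).W = lo (fun n => (z n).G) n := by
  induction n with
  | zero => exact lo_zero.symm
  | succ n ih =>
    rw [lo_succ, ← ih, Tri.gen]
    cases σ n <;> rfl

theorem Tri.sum_mem_gen {z : ℕ → Blk X} (σ : ℕ → Bool) {f g : ℕ → X}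
    (hf : ∀ n, f n ∈ if σ n then (z n).F else (z n).G)
    (hg : ∀ n, g n ∈ if σ n then (z n).G else (z n).F) (n : ℕ) :
    ∑ i ∈ Finset.range n, f i ∈ (Tri.gen z σ n).E ∧
      ∑ i ∈ Finset.range n, g i ∈ (Tri.gen z σ n).F := by
  induction n with
  | zero => simp
  | succ n ih =>
    have h1 := hf n
    have h2 := hg n
    rw [Finset.sum_range_succ, Finset.sum_range_succ, Tri.gen]
    revert h1 h2
    cases σ n <;> intro h1 h2 <;>
      exact ⟨Submodule.add_mem_sup ih.1 (by simpa using h1),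
        Submodule.add_mem_sup ih.2 (by simpa using h2)⟩

theorem Tri.gen_W_le {z : ℕ → Blk X} (hz : IsSeq x z) (σ : ℕ → Bool) (n : ℕ) :
    (Tri.gen z σ n).W ≤ (Tri.gen z σ n).E := by
  induction n with
  | zero => exact le_rfl
  | succ n ih =>
    rw [Tri.gen]
    cases σ n
    · exact sup_le_sup ih le_rfl
    · exact sup_le_sup ih (hz.G_le_F n)

theorem infDist_signed_sum_le {z : ℕ → Blk X} (hz : IsSeq x z) {K : ℝ} (hK : 0 ≤ K)
    (h : ∀ σ n, IsSep K (Tri.gen z σ n).E (Tri.gen z σ n).F (Tri.gen z σ n).W) {ζ : ℕ → X}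
    (hζ : ∀ n, ζ n ∈ (z n).F) {ε : ℕ → ℝ} (hε : ∀ n, ε n = 1 ∨ ε n = -1) (c : ℕ → ℝ) (N : ℕ) :
    Metric.infDist (∑ n ∈ Finset.range N, (ε n * c n) • ζ n) (⨆ n, (z n).G : Submodule ℝ X) ≤
      K * Metric.infDist (∑ n ∈ Finset.range N, c n • ζ n) (⨆ n, (z n).G : Submodule ℝ X) := by
  have key : ∀ (c : ℕ → ℝ) (M : ℕ), ∀ g ∈ lo (fun n => (z n).G) M,
      Metric.infDist (∑ n ∈ Finset.range M, (ε n * c n) • ζ n) (⨆ n, (z n).G : Submodule ℝ X) ≤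
        K * ‖∑ n ∈ Finset.range M, c n • ζ n - g‖ := by
    intro c M g hg
    let σ : ℕ → Bool := fun n => decide (ε n = 1)
    have hmem := Tri.sum_mem_gen (z := z) σ (f := fun n => if σ n then c n • ζ n else 0)
      (g := fun n => if σ n then 0 else c n • ζ n)
      (fun n => by
        split_ifs
        · exact Submodule.smul_mem _ _ (hζ n)
        · exact zero_mem _)
      (fun n => by
        split_ifs
        · exact zero_mem _
        · exact Submodule.smul_mem _ _ (hζ n)) M
    rw [← Tri.gen_W z σ] at hg
    have h1 := h σ M _ (sub_mem hmem.1 (Tri.gen_W_le hz σ M hg)) _ hmem.2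
    rw [sub_add_eq_add_sub, ← Finset.sum_add_distrib, sub_right_comm, ← Finset.sum_sub_distrib,
      Tri.gen_W] at h1
    rw [Tri.gen_W] at hg
    have h2 := h1
    rw [sub_eq_add_neg, infDist_add_mem (neg_mem hg)] at h2
    refine (infDist_anti (lo_le_iSup M) _).trans ?_
    have e1 : ∀ n, ((if σ n = true then c n • ζ n else 0) - if σ n = true then 0 else c n • ζ n)
        = (ε n * c n) • ζ n := fun n => by
      rcases hε n with hn | hn
      · simp [σ, hn]
      · simp [σ, hn]
        norm_num
    have e2 : ∀ n, ((if σ n = true then c n • ζ n else 0) + if σ n = true then 0 else c n • ζ n)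
        = c n • ζ n := fun n => by split_ifs <;> simp
    simpa only [e1, e2] using h2
  rcases hK.eq_or_lt with rfl | hK
  · have := key c N 0 (zero_mem _)
    simpa using this
  rw [mul_comm, ← div_le_iff₀ hK]
  refine le_infDist_of_forall fun g hg => ?_
  rw [div_le_iff₀ hK, mul_comm]
  obtain ⟨M, hM⟩ := exists_mem_lo hg
  have h1 := key (fun i => if i < N then c i else 0) (max N M) g (lo_mono (le_max_right _ _) hM)
  have h3 : ∀ f : ℕ → X, ∑ i ∈ Finset.range (max N M), (if i < N then f i else 0)
      = ∑ i ∈ Finset.range N, f i := by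
    intro f
    rw [← Finset.sum_filter]
    refine Finset.sum_congr ?_ fun _ _ => rfl
    ext i; simp; omega
  simpa only [mul_ite, mul_zero, ite_smul, zero_smul, h3] using h1

theorem exists_thin {z : ℕ → Blk X} (hz : IsSeq x z) :
    ∃ (z' : ℕ → Blk X) (ζ : ℕ → X), IsSeq x z' ∧ (∀ n, (z' n).G = (z n).G) ∧
      (∀ n, ζ n ∈ (z n).F) ∧ ∀ n, (z' n).F = (z n).G ⊔ Submodule.span ℝ {ζ n} := by
  choose ζ hζ hζG using fun n => SetLike.exists_of_lt (hz n).2.2.1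
  refine ⟨fun n => { z n with F := (z n).G ⊔ Submodule.span ℝ {ζ n} }, ζ, fun n => ?_,
    fun _ => rfl, hζ, fun _ => rfl⟩
  refine ⟨(hz n).1, (hz n).2.1, lt_of_le_of_ne le_sup_left fun h => hζG n ?_, ?_⟩
  · have : ζ n ∈ (z n).G ⊔ Submodule.span ℝ {ζ n} :=
      Submodule.mem_sup_right (Submodule.mem_span_singleton_self _)
    exact h ▸ this
  · refine le_trans (sup_le (hz.G_le_F n) ?_) (hz n).2.2.2
    rw [Submodule.span_singleton_le_iff_mem]
    exact hζ n

theorem exists_unconditional_basis {Y : Type*} [SeminormedAddCommGroup Y] [NormedSpace ℝ Y]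
    [T2Space Y] [CompleteSpace Y] (hx : BK x) {z z' : ℕ → Blk X} {ζ : ℕ → X} (hz : IsSeq x z)
    (hz' : IsSeq x z') (hG : ∀ n, (z' n).G = (z n).G) (hζ : ∀ n, ζ n ∈ (z n).F)
    (hF : ∀ n, (z' n).F = (z n).G ⊔ Submodule.span ℝ {ζ n}) {K : ℝ} (hK : 1 ≤ K)
    (h : ∀ σ n, IsSep K (Tri.gen z σ n).E (Tri.gen z σ n).F (Tri.gen z σ n).W)
    {φ : X →ₗ[ℝ] Y} (hφ : IsRep φ (⨆ n, (z' n).F) (⨆ n, (z' n).G)) :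
    IsFDD (fun n => (z' n).F.map φ) ∧ IsUnconditionalSchauderBasis K fun n => φ (ζ n) := by
  have hfdd := hz'.isFDD hx hφ
  refine ⟨hfdd, ?_⟩
  have hζF : ∀ n, ζ n ∈ (z' n).F := fun n => by
    rw [hF]; exact Submodule.mem_sup_right (Submodule.mem_span_singleton_self _)
  have hmap : (fun n => (z' n).F.map φ) = fun n => Submodule.span ℝ {φ (ζ n)} := by
    funext n
    rw [hF, Submodule.map_sup, Submodule.map_span, Set.image_singleton, sup_eq_right]
    rintro _ ⟨g, hg, rfl⟩
    have hg : g ∈ (z n).G := hg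
    rw [← hG] at hg
    have : φ g = 0 := by
      refine eq_zero_of_norm_eq_zero ?_
      rw [hφ.norm_eq g (le_iSup (fun n => (z' n).F) n (hz'.G_le_F n hg))]
      exact Metric.infDist_zero_of_mem (le_iSup (fun n => (z' n).G) n hg)
    rw [this]; exact zero_mem _
  rw [hmap] at hfdd
  refine hfdd.isSchauderBasis.isUnconditional hK fun ε hε c N => ?_
  have hsum : ∀ c : ℕ → ℝ, ‖∑ n ∈ Finset.range N, c n • φ (ζ n)‖ =
      Metric.infDist (∑ n ∈ Finset.range N, c n • ζ n) (⨆ n, (z n).G : Submodule ℝ X) := by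
    intro c
    have h1 : ∑ n ∈ Finset.range N, c n • ζ n ∈ ⨆ n, (z' n).F := sum_mem fun n _ =>
      le_iSup (fun n => (z' n).F) n (Submodule.smul_mem _ _ (hζF n))
    have h2 := hφ.norm_eq _ h1
    simp only [map_sum, map_smul] at h2
    rw [h2, iSup_congr hG]
  rw [hsum, hsum]
  exact infDist_signed_sum_le hz (by linarith) h hζ hε c N

end

section
variable {X : Type*} [AddCommGroup X] [Module ℝ X] {F G : ℕ → Submodule ℝ X} {x : ℕ → X}
  {s : ℕ → ℕ}

/-- Sum of the subspaces with index in `[l, m)`. -/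
def mid (F : ℕ → Submodule ℝ X) (l m : ℕ) : Submodule ℝ X := lo (fun i => ⨆ _ : l ≤ i, F i) m

theorem le_mid {l m i : ℕ} (h : l ≤ i) (h' : i < m) : F i ≤ mid F l m :=
  le_trans (le_iSup_of_le h le_rfl) (le_lo (F := fun i => ⨆ _ : l ≤ i, F i) h')

theorem mid_le {l m : ℕ} {S : Submodule ℝ X} (h : ∀ i, l ≤ i → i < m → F i ≤ S) :
    mid F l m ≤ S :=
  iSup₂_le fun i hi => iSup_le fun hl => h i hl hi

theorem mid_le_hi {l m n : ℕ} (h : n ≤ l) : mid F l m ≤ hi F n :=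
  mid_le fun _ h1 _ => le_hi (h.trans h1)

theorem mid_le_lo {l m n : ℕ} (h : m ≤ n) : mid F l m ≤ lo F n :=
  mid_le fun _ _ h1 => le_lo (h1.trans_le h)

theorem mid_mono {l l' m m' : ℕ} (h : l' ≤ l) (h' : m ≤ m') : mid F l m ≤ mid F l' m' :=
  mid_le fun _ h1 h2 => le_mid (h.trans h1) (h2.trans_le h')

theorem mid_le_iSup {l m : ℕ} : mid F l m ≤ ⨆ n, F n := mid_le fun i _ _ => le_iSup F i

theorem mid_mono_fun (h : ∀ n, G n ≤ F n) {l m : ℕ} : mid G l m ≤ mid F l m :=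
  mid_le fun i h1 h2 => (h i).trans (le_mid h1 h2)

theorem exists_mem_mid {l : ℕ} {y : X} (hy : y ∈ hi F l) : ∃ m, l < m ∧ y ∈ mid F l m := by
  obtain ⟨m, hm⟩ := exists_mem_lo (F := fun i => ⨆ _ : l ≤ i, F i) hy
  exact ⟨max m (l + 1), by omega, lo_mono (le_max_left _ _) hm⟩

/-- Data for merging blocks: the new pairs are supported on the intervals given by `k` and
the new denominators contain all old denominators. -/
structure IsMerge (p : ℕ → Blk X) (k : ℕ → ℕ) (F' G' : ℕ → Submodule ℝ X) : Prop where
  part : SuccPartition k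
  le : ∀ n, G' n ≤ F' n
  F_le : ∀ n, F' n ≤ ⨆ i ∈ Finset.Ico (k n) (k (n + 1)), (p i).F
  G_le : ∀ n i, k n ≤ i → i < k (n + 1) → (p i).G ≤ G' n

variable {p : ℕ → Blk X} {k : ℕ → ℕ} {F' G' : ℕ → Submodule ℝ X}

theorem SuccPartition.exists_mem (hk : SuccPartition k) (i : ℕ) :
    ∃ n, k n ≤ i ∧ i < k (n + 1) :=
  exists_between_of_strictMono hk.1 (by rw [hk.2]; exact Nat.zero_le i)

theorem IsMerge.isBlocks (h : IsMerge p k F' G') (hp : IsSeq x p) :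
    IsBlocks x (fun n => (p (k n)).s) F' G' := by
  refine ⟨fun a b hab => hp.s_le_iff.2 (h.part.1.monotone hab), h.le, fun n =>
    (h.F_le n).trans (iSup₂_le fun i hi => ?_)⟩
  rw [Finset.mem_Ico] at hi
  refine (hp i).2.2.2.trans (sp_mono x (hp.s_le_iff.2 hi.1) ?_)
  rw [hp.t_eq]
  exact hp.s_le_iff.2 hi.2

theorem IsMerge.iSup_G_le (h : IsMerge p k F' G') : ⨆ i, (p i).G ≤ ⨆ n, G' n := by
  refine iSup_le fun i => ?_
  obtain ⟨n, h1, h2⟩ := h.part.exists_mem i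
  exact (h.G_le n i h1 h2).trans (le_iSup G' n)

theorem IsMerge.made (h : IsMerge p k F' G') (hp : IsSeq x p) {l m : ℕ} (hlm : l < m) {w : X}
    (hw : w ∈ mid F' l m) (hwG : w ∉ mid G' l m) :
    Made ⟨(p (k l)).s, (p (k m)).s, mid G' l m ⊔ Submodule.span ℝ {w}, mid G' l m⟩ p := by
  have hG : ∀ i, (p (k l)).s ≤ (p i).s → (p i).t ≤ (p (k m)).s → (p i).G ≤ mid G' l m := by
    intro i h1 h2
    rw [hp.t_eq] at h2
    replace h1 := hp.s_le_iff.1 h1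
    replace h2 := hp.s_le_iff.1 h2
    obtain ⟨n, h3, h4⟩ := h.part.exists_mem i
    refine (h.G_le n i h3 h4).trans (le_mid ?_ ?_)
    · exact Nat.lt_succ_iff.1 (h.part.1.lt_iff_lt.1 (lt_of_le_of_lt h1 h4))
    · exact h.part.1.lt_iff_lt.1 (lt_of_le_of_lt h3 h2)
  refine ⟨⟨_, rfl⟩, ⟨_, rfl⟩, hp.s_lt_iff.2 (h.part.1 hlm), hG,
    lt_of_le_of_ne le_sup_left fun e => hwG ?_, ?_⟩
  · have : w ∈ mid G' l m ⊔ Submodule.span ℝ {w} :=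
      Submodule.mem_sup_right (Submodule.mem_span_singleton_self _)
    dsimp only at e
    rwa [← e] at this
  · have h1 : mid G' l m ⊔ Submodule.span ℝ {w} ≤ mid F' l m :=
      sup_le (mid_mono_fun h.le) (by rwa [Submodule.span_singleton_le_iff_mem])
    refine h1.trans (mid_le fun n hn1 hn2 => (h.F_le n).trans (iSup₂_le fun i hi => ?_))
    rw [Finset.mem_Ico] at hi
    refine le_iSup₂_of_le i ⟨hp.s_le_iff.2 ((h.part.1.monotone hn1).trans hi.1), ?_⟩ le_rfl
    rw [hp.t_eq]
    exact hp.s_le_iff.2 (le_trans hi.2 (h.part.1.monotone hn2))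

end

section
variable {X : Type*} [NormedAddCommGroup X] [NormedSpace ℝ X] {x : ℕ → X}
  {p : ℕ → Blk X} {k : ℕ → ℕ}
  {Y : Type*} [SeminormedAddCommGroup Y] [NormedSpace ℝ Y] {φ : X →ₗ[ℝ] Y}
  {E : Type*} [SeminormedAddCommGroup E] [NormedSpace ℝ E]

theorem exists_isMerge [T2Space Y] (hp : IsSeq x p) (hφ : IsRep φ (⨆ n, (p n).F) (⨆ n, (p n).G))
    (hk : SuccPartition k) {F G : ℕ → Submodule ℝ Y} (hGF : ∀ n, G n ≤ F n)
    (hF : ∀ n, F n ≤ ⨆ i ∈ Finset.Ico (k n) (k (n + 1)), (p i).F.map φ) {ψ : Y →ₗ[ℝ] E}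
    (hψ : IsRep ψ (⨆ n, F n) (⨆ n, G n)) :
    ∃ F' G' : ℕ → Submodule ℝ X, IsMerge p k F' G' ∧
      IsRep (ψ ∘ₗ φ) (⨆ n, F' n) (⨆ n, G' n) := by
  let P : ℕ → Submodule ℝ X := fun n => ⨆ i ∈ Finset.Ico (k n) (k (n + 1)), (p i).F
  have hPF : ∀ n, P n ≤ ⨆ n, (p n).F := fun n => iSup₂_le fun i _ => le_iSup (fun n => (p n).F) i
  have hmapP : ∀ n, (P n).map φ = ⨆ i ∈ Finset.Ico (k n) (k (n + 1)), (p i).F.map φ := fun n => by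
    simp only [P, Submodule.map_iSup]
  have hmap : ∀ H : ℕ → Submodule ℝ Y, (∀ n, H n ≤ F n) →
      (⨆ n, P n ⊓ (H n).comap φ).map φ = ⨆ n, H n := by
    intro H hH
    rw [Submodule.map_iSup]
    refine iSup_congr fun n => le_antisymm ?_ fun y hy => ?_
    · rintro _ ⟨a, ha, rfl⟩; exact ha.2
    · have := (hH n).trans (hF n) hy
      rw [← hmapP] at this
      obtain ⟨a, ha, rfl⟩ := this
      exact ⟨a, ⟨ha, hy⟩, rfl⟩
  have hφ0 : ∀ i, ∀ a ∈ (p i).G, φ a = 0 := fun i a ha => by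
    refine eq_zero_of_norm_eq_zero ?_
    rw [hφ.norm_eq a (le_iSup (fun n => (p n).F) i (hp.G_le_F i ha))]
    exact Metric.infDist_zero_of_mem (le_iSup (fun n => (p n).G) i ha)
  have hM : IsMerge p k (fun n => P n ⊓ (F n).comap φ) fun n => P n ⊓ (G n).comap φ := by
    refine ⟨hk, fun n => inf_le_inf_left _ (Submodule.comap_mono (hGF n)), fun n => inf_le_left,
      fun n i h1 h2 a ha => ⟨?_, ?_⟩⟩
    · exact (le_iSup₂_of_le (f := fun i (_ : i ∈ Finset.Ico (k n) (k (n + 1))) => (p i).F) i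
        (Finset.mem_Ico.2 ⟨h1, h2⟩) le_rfl : (p i).F ≤ P n) (hp.G_le_F i ha)
    · change φ a ∈ G n
      rw [hφ0 i a ha]
      exact zero_mem _
  refine ⟨_, _, hM, fun a ha => ?_, fun y ε hε => ?_⟩
  · have hle : (⨆ n, P n ⊓ (F n).comap φ) ≤ ⨆ n, (p n).F :=
      iSup_le fun n => inf_le_left.trans (hPF n)
    have hφa : φ a ∈ ⨆ n, F n := by
      rw [← hmap F fun _ => le_rfl]
      exact Submodule.mem_map_of_mem ha
    have hle' : (⨆ n, P n ⊓ (G n).comap φ) ≤ ⨆ n, P n ⊓ (F n).comap φ := iSup_mono hM.le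
    rw [LinearMap.comp_apply, hψ.norm_eq _ hφa]
    refine le_antisymm (le_infDist_of_forall fun g hg => ?_) (le_infDist_of_forall fun g hg => ?_)
    · have h1 : φ g ∈ ⨆ n, G n := by
        rw [← hmap G hGF]
        exact Submodule.mem_map_of_mem hg
      refine (infDist_le_norm_sub h1 _).trans ?_
      rw [← map_sub, hφ.norm_eq _ (sub_mem (hle ha) (hle (hle' hg)))]
      exact infDist_le_norm _ _
    · rw [← hmap G hGF] at hg
      obtain ⟨g, hg, rfl⟩ := hg
      rw [← map_sub, hφ.norm_eq _ (sub_mem (hle ha) (hle (hle' hg)))]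
      refine le_trans ?_ (infDist_anti hM.iSup_G_le _)
      rw [sub_eq_add_neg, infDist_add_mem (neg_mem hg)]
  · obtain ⟨b, hb, hyb⟩ := hψ.dense y ε hε
    rw [← hmap F fun _ => le_rfl] at hb
    obtain ⟨a, ha, rfl⟩ := hb
    exact ⟨a, ha, hyb⟩

theorem exists_far [T2Space E] {F G : ℕ → Submodule ℝ X} {s : ℕ → ℕ}
    (h : IsBlocks x s F G) {χ : X →ₗ[ℝ] E} (hχ : IsRep χ (⨆ n, F n) (⨆ n, G n))
    {U : Submodule ℝ E} (hU : ¬FiniteDimensional ℝ U) (l : ℕ) {ε : ℝ} (hε : 0 < ε) :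
    ∃ m w, l < m ∧ w ∈ mid F l m ∧ ‖χ w‖ = 1 ∧ ∃ u ∈ U, ‖χ w - u‖ ≤ ε := by
  set A := (lo F l).map χ with hA
  set T := ((hi F l).map χ).topologicalClosure with hT
  have := h.finite_lo l
  have hAfin : FiniteDimensional ℝ A := by infer_instance
  have htop : T ⊔ A = ⊤ := by
    have hcl : IsClosed ((T ⊔ A : Submodule ℝ E) : Set E) :=
      Submodule.isClosed_sup_finiteDimensional _ _ (Submodule.isClosed_topologicalClosure _)
    refine eq_top_iff.2 fun y _ => ?_
    have : y ∈ closure ((T ⊔ A : Submodule ℝ E) : Set E) := by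
      refine Metric.mem_closure_iff.2 fun ε hε => ?_
      obtain ⟨a, ha, hya⟩ := hχ.dense y ε hε
      refine ⟨χ a, ?_, by rwa [dist_eq_norm]⟩
      rw [← lo_sup_hi l] at ha
      obtain ⟨b, hb, c, hc, rfl⟩ := Submodule.mem_sup.1 ha
      rw [map_add, add_comm]
      exact Submodule.add_mem_sup
        (Submodule.le_topologicalClosure _ (Submodule.mem_map_of_mem hc))
        (Submodule.mem_map_of_mem hb)
    rwa [hcl.closure_eq] at this
  have hUT : U ⊓ T ≠ ⊥ := by
    intro hbot
    have hq : FiniteDimensional ℝ (E ⧸ T) := by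
      refine Module.Finite.of_surjective (T.mkQ ∘ₗ A.subtype) fun y => ?_
      obtain ⟨y, rfl⟩ := T.mkQ_surjective y
      have : y ∈ T ⊔ A := by rw [htop]; trivial
      obtain ⟨t, ht, a, ha, rfl⟩ := Submodule.mem_sup.1 this
      refine ⟨⟨a, ha⟩, ?_⟩
      have : T.mkQ t = 0 := by simpa using ht
      simp only [LinearMap.comp_apply, Submodule.subtype_apply, map_add, this, zero_add]
    refine hU (Module.Finite.of_injective (T.mkQ ∘ₗ U.subtype) ?_)
    refine (injective_iff_map_eq_zero _).2 fun u hu => ?_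
    have h1 : (u : E) ∈ T := by simpa using hu
    have h2 : (u : E) ∈ U ⊓ T := ⟨u.2, h1⟩
    rw [hbot, Submodule.mem_bot] at h2
    exact Subtype.ext h2
  obtain ⟨u, hu, hu0⟩ := (Submodule.ne_bot_iff _).1 hUT
  have hun : 0 < ‖u‖ :=
    lt_of_le_of_ne (norm_nonneg _) fun h0 => hu0 (eq_zero_of_norm_eq_zero h0.symm)
  set δ := min (ε / 2) (1 / 2) with hδ
  have hδ0 : 0 < δ := by positivity
  have hδ1 : δ ≤ ε / 2 := min_le_left _ _
  have hδ2 : δ ≤ 1 / 2 := min_le_right _ _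
  obtain ⟨_, ⟨a, ha, rfl⟩, hua⟩ := Metric.mem_closure_iff.1 hu.2 (δ * ‖u‖) (by positivity)
  rw [dist_eq_norm] at hua
  have ha1 : ‖u‖ / 2 ≤ ‖χ a‖ := by
    have := norm_sub_norm_le u (χ a)
    nlinarith
  have ha0 : 0 < ‖χ a‖ := by linarith
  obtain ⟨m, hm, ham⟩ := exists_mem_mid ha
  refine ⟨m, ‖χ a‖⁻¹ • a, hm, Submodule.smul_mem _ _ ham, ?_, ‖χ a‖⁻¹ • u,
    Submodule.smul_mem _ _ hu.1, ?_⟩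
  · rw [map_smul, norm_smul, norm_inv, norm_norm, inv_mul_cancel₀ ha0.ne']
  · rw [map_smul, ← smul_sub, norm_smul, norm_inv, norm_norm, norm_sub_rev, inv_mul_le_iff₀ ha0]
    nlinarith

theorem exists_pairs [T2Space E] {F G : ℕ → Submodule ℝ X} {s : ℕ → ℕ}
    (h : IsBlocks x s F G) {χ : X →ₗ[ℝ] E} (hχ : IsRep χ (⨆ n, F n) (⨆ n, G n))
    {U V : Submodule ℝ E} (hU : ¬FiniteDimensional ℝ U) (hV : ¬FiniteDimensional ℝ V) {ε : ℕ → ℝ}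
    (hε : ∀ n, 0 < ε n) :
    ∃ (l m : ℕ → ℕ) (w w' : ℕ → X), l 0 = 0 ∧ (∀ n, l n < m n ∧ m n < l (n + 1)) ∧
      (∀ n, w n ∈ mid F (l n) (m n) ∧ ‖χ (w n)‖ = 1 ∧ ∃ u ∈ U, ‖χ (w n) - u‖ ≤ ε n) ∧
      ∀ n, w' n ∈ mid F (m n) (l (n + 1)) ∧ ‖χ (w' n)‖ = 1 ∧ ∃ v ∈ V, ‖χ (w' n) - v‖ ≤ ε n := by
  choose M f hM hf1 hf2 hf3 using fun (l : ℕ) (e : {e : ℝ // 0 < e}) =>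
    exists_far h hχ hU l e.2
  choose L g hL hg1 hg2 hg3 using fun (l : ℕ) (e : {e : ℝ // 0 < e}) =>
    exists_far h hχ hV l e.2
  let l : ℕ → ℕ := fun n => Nat.rec 0 (fun n a => L (M a ⟨ε n, hε n⟩) ⟨ε n, hε n⟩) n
  exact ⟨l, fun n => M (l n) ⟨ε n, hε n⟩, fun n => f (l n) ⟨ε n, hε n⟩,
    fun n => g (M (l n) ⟨ε n, hε n⟩) ⟨ε n, hε n⟩, rfl, fun n => ⟨hM _ _, hL _ _⟩,
    fun n => ⟨hf1 _ _, hf2 _ _, hf3 _ _⟩, fun n => ⟨hg1 _ _, hg2 _ _, hg3 _ _⟩⟩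

end

theorem exists_sum_of_mem_iSup {X : Type*} [AddCommGroup X] [Module ℝ X] {H : ℕ → Submodule ℝ X}
    {S : Submodule ℝ X} (hH : ∀ n, H n ≤ S) {w : ℕ → X} {y : X}
    (hy : y ∈ ⨆ n, H n ⊔ Submodule.span ℝ {w n}) :
    ∃ g ∈ S, ∃ (a : ℕ → ℝ) (N₀ : ℕ), ∀ N, N₀ ≤ N → y = g + ∑ n ∈ Finset.range N, a n • w n := by
  have hle : ⨆ n, H n ⊔ Submodule.span ℝ {w n} ≤ S ⊔ Submodule.span ℝ (Set.range w) :=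
    iSup_le fun n => sup_le_sup (hH n)
      (Submodule.span_mono (Set.singleton_subset_iff.2 (Set.mem_range_self n)))
  obtain ⟨g, hg, z, hz, rfl⟩ := Submodule.mem_sup.1 (hle hy)
  obtain ⟨c, rfl⟩ := Finsupp.mem_span_range_iff_exists_finsupp.1 hz
  obtain ⟨N₀, hN₀⟩ := c.support.exists_nat_subset_range
  refine ⟨g, hg, c, N₀, fun N hN => ?_⟩
  rw [Finsupp.sum_of_support_subset c (hN₀.trans (Finset.range_mono hN)) _ (by simp)]

section
variable {X : Type*} [NormedAddCommGroup X] [NormedSpace ℝ X] {x : ℕ → X}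
  {E : Type*} [SeminormedAddCommGroup E] [NormedSpace ℝ E]

theorem IsBlocks.abs_coeff_le {F G : ℕ → Submodule ℝ X} {s : ℕ → ℕ}
    (h : IsBlocks x s F G) (hx : BK x) {χ : X →ₗ[ℝ] E} (hχ : IsRep χ (⨆ n, F n) (⨆ n, G n))
    {l m : ℕ → ℕ} {w w' : ℕ → X} (hl : ∀ n, l n < m n ∧ m n < l (n + 1))
    (hw : ∀ n, w n ∈ mid F (l n) (m n)) (hw1 : ∀ n, ‖χ (w n)‖ = 1)
    (hw' : ∀ n, w' n ∈ mid F (m n) (l (n + 1))) (hw1' : ∀ n, ‖χ (w' n)‖ = 1)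
    (a b : ℕ → ℝ) {N n : ℕ} (hn : n < N) :
    |a n| ≤ 4 * ‖χ (∑ i ∈ Finset.range N, (a i • w i + b i • w' i))‖ ∧
      |b n| ≤ 4 * ‖χ (∑ i ∈ Finset.range N, (a i • w i + b i • w' i))‖ := by
  have hmono : Monotone l := monotone_nat_of_le_succ fun n => by have := hl n; omega
  set f : ℕ → X := fun i => a i • w i + b i • w' i with hf
  have hfm : ∀ i, f i ∈ mid F (l i) (l (i + 1)) := fun i =>
    add_mem (Submodule.smul_mem _ _ (mid_mono le_rfl (hl i).2.le (hw i)))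
      (Submodule.smul_mem _ _ (mid_mono (hl i).1.le le_rfl (hw' i)))
  have hlo : ∀ n, ∑ i ∈ Finset.range n, f i ∈ lo F (l n) := fun n => sum_mem fun i hi =>
    mid_le_lo (hmono (Finset.mem_range.1 hi)) (hfm i)
  have hhi : ∀ n, ∑ i ∈ Finset.Ico n N, f i ∈ hi F (l n) := fun n => sum_mem fun i hi =>
    mid_le_hi (hmono (Finset.mem_Ico.1 hi).1) (hfm i)
  have h1 : ∀ n ≤ N, ‖χ (∑ i ∈ Finset.range n, f i)‖ ≤ 2 * ‖χ (∑ i ∈ Finset.range N, f i)‖ := by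
    intro n hn
    have := h.norm_le hx hχ (hlo n) (hhi n)
    rwa [Finset.sum_range_add_sum_Ico _ hn] at this
  have h2 : ‖χ (∑ i ∈ Finset.range n, f i + a n • w n)‖ ≤
      2 * ‖χ (∑ i ∈ Finset.range N, f i)‖ := by
    have := h.norm_le hx hχ (n := m n)
      (add_mem (lo_mono (hl n).1.le (hlo n))
        (Submodule.smul_mem _ (a n) (mid_le_lo le_rfl (hw n))))
      (add_mem (Submodule.smul_mem _ (b n) (mid_le_hi le_rfl (hw' n)))
        (hi_anti (hl n).2.le (hhi (n + 1))))
    have e : ∑ i ∈ Finset.range N, f i = ∑ i ∈ Finset.range n, f i + a n • w n +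
        (b n • w' n + ∑ i ∈ Finset.Ico (n + 1) N, f i) := by
      rw [← Finset.sum_range_add_sum_Ico f (Nat.succ_le_of_lt hn), Finset.sum_range_succ]
      simp only [hf]
      abel
    rwa [e]
  have h3 := h1 n hn.le
  have h4 := h1 (n + 1) hn
  have ha : |a n| = ‖χ (a n • w n)‖ := by
    rw [map_smul, norm_smul, hw1, mul_one, Real.norm_eq_abs]
  have hb : |b n| = ‖χ (b n • w' n)‖ := by
    rw [map_smul, norm_smul, hw1', mul_one, Real.norm_eq_abs]
  constructor
  · rw [ha, show a n • w n = (∑ i ∈ Finset.range n, f i + a n • w n) - ∑ i ∈ Finset.range n, f i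
      by abel, map_sub]
    linarith [norm_sub_le (χ (∑ i ∈ Finset.range n, f i + a n • w n))
      (χ (∑ i ∈ Finset.range n, f i))]
  · have : b n • w' n = ∑ i ∈ Finset.range (n + 1), f i -
        (∑ i ∈ Finset.range n, f i + a n • w n) := by
      rw [Finset.sum_range_succ]; simp only [hf]; abel
    rw [hb, this, map_sub]
    linarith [norm_sub_le (χ (∑ i ∈ Finset.range (n + 1), f i))
      (χ (∑ i ∈ Finset.range n, f i + a n • w n))]

theorem norm_sub_le_of_pairs {F G : ℕ → Submodule ℝ X} {s : ℕ → ℕ}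
    (h : IsBlocks x s F G) (hx : BK x) {χ : X →ₗ[ℝ] E} (hχ : IsRep χ (⨆ n, F n) (⨆ n, G n))
    {U V : Submodule ℝ E} {C : ℝ} (hC : 0 ≤ C) (hUV : ∀ u ∈ U, ∀ v ∈ V, ‖u‖ ≤ C * ‖u + v‖)
    {ε : ℕ → ℝ} (hε : ∀ N, ∑ n ∈ Finset.range N, ε n ≤ 1 / 8)
    {l m : ℕ → ℕ} {w w' : ℕ → X} (hl : ∀ n, l n < m n ∧ m n < l (n + 1))
    (hw : ∀ n, w n ∈ mid F (l n) (m n) ∧ ‖χ (w n)‖ = 1 ∧ ∃ u ∈ U, ‖χ (w n) - u‖ ≤ ε n)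
    (hw' : ∀ n, w' n ∈ mid F (m n) (l (n + 1)) ∧ ‖χ (w' n)‖ = 1 ∧
      ∃ v ∈ V, ‖χ (w' n) - v‖ ≤ ε n) (a b : ℕ → ℝ) (N : ℕ) :
    ‖χ (∑ i ∈ Finset.range N, a i • w i - ∑ i ∈ Finset.range N, b i • w' i)‖ ≤
      (4 * C + 3) * ‖χ (∑ i ∈ Finset.range N, a i • w i + ∑ i ∈ Finset.range N, b i • w' i)‖ := by
  have hco := fun n hn => h.abs_coeff_le hx hχ hl (fun n => (hw n).1) (fun n => (hw n).2.1)
    (fun n => (hw' n).1) (fun n => (hw' n).2.1) a b (N := N) (n := n) hn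
  rw [Finset.sum_add_distrib] at hco
  set y := ∑ i ∈ Finset.range N, a i • w i
  set y' := ∑ i ∈ Finset.range N, b i • w' i
  set D := ‖χ (y + y')‖ with hD
  have hD0 : 0 ≤ D := norm_nonneg _
  choose u hu hu' using fun n => (hw n).2.2
  choose v hv hv' using fun n => (hw' n).2.2
  set U0 := ∑ i ∈ Finset.range N, a i • u i
  set V0 := ∑ i ∈ Finset.range N, b i • v i
  have hU0 : U0 ∈ U := sum_mem fun i _ => U.smul_mem _ (hu i)
  have hV0 : V0 ∈ V := sum_mem fun i _ => V.smul_mem _ (hv i)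
  have est : ∀ (c : ℕ → ℝ) (q r : ℕ → E), (∀ i < N, |c i| ≤ 4 * D) → (∀ i, ‖q i - r i‖ ≤ ε i) →
      ‖∑ i ∈ Finset.range N, c i • q i - ∑ i ∈ Finset.range N, c i • r i‖ ≤ D / 2 := by
    intro c q r hc hqr
    rw [← Finset.sum_sub_distrib]
    calc _ ≤ ∑ i ∈ Finset.range N, 4 * D * ε i := norm_sum_le_of_le _ fun i hi => by
            rw [← smul_sub, norm_smul, Real.norm_eq_abs]
            exact mul_le_mul (hc i (Finset.mem_range.1 hi)) (hqr i) (norm_nonneg _) (by positivity)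
      _ ≤ D / 2 := by
            rw [← Finset.mul_sum]
            nlinarith [hε N]
  have e1 : ‖χ y - U0‖ ≤ D / 2 := by
    simpa [y, map_sum] using est a (fun i => χ (w i)) u (fun i hi => (hco i hi).1) hu'
  have e2 : ‖χ y' - V0‖ ≤ D / 2 := by
    simpa [y', map_sum] using est b (fun i => χ (w' i)) v (fun i hi => (hco i hi).2) hv'
  have e3 : ‖U0 + V0‖ ≤ 2 * D := by
    have : U0 + V0 = χ (y + y') - (χ y - U0) - (χ y' - V0) := by rw [map_add]; abel
    rw [this]
    have t1 := norm_sub_le (χ (y + y') - (χ y - U0)) (χ y' - V0)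
    have t2 := norm_sub_le (χ (y + y')) (χ y - U0)
    linarith
  have e4 : ‖U0 - V0‖ ≤ (2 * C + 1) * ‖U0 + V0‖ := by
    have : U0 - V0 = U0 + U0 - (U0 + V0) := by abel
    rw [this]
    have t1 := norm_sub_le (U0 + U0) (U0 + V0)
    have t2 := norm_add_le U0 U0
    linarith [hUV _ hU0 _ hV0]
  have e5 : ‖χ (y - y')‖ ≤ ‖U0 - V0‖ + D := by
    have : χ (y - y') = (U0 - V0) + (χ y - U0) - (χ y' - V0) := by rw [map_sub]; abel
    rw [this]
    have t1 := norm_sub_le ((U0 - V0) + (χ y - U0)) (χ y' - V0)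
    have t2 := norm_add_le (U0 - V0) (χ y - U0)
    linarith
  have e6 : (2 * C + 1) * ‖U0 + V0‖ ≤ (2 * C + 1) * (2 * D) := by gcongr
  linarith

theorem IsSeq.isSep_tail (hx : BK x) {u v : ℕ → Blk X} (hu : IsSeq x u) (hv : IsSeq x v)
    (hs : ∀ n, (u n).s = (v n).s) {M : ℝ}
    (h : IsSep M (⨆ n, (u n).F) (⨆ n, (v n).F) (⨆ n, (u n).G)) (j : ℕ) :
    IsSep (3 * M) (⨆ n, (u (n + j)).F) (⨆ n, (v (n + j)).F) (⨆ n, (u (n + j)).G) := by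
  intro y hy z hz
  have hyz := h y ((iSup_le fun n => le_iSup (fun n => (u n).F) (n + j) :
    ⨆ n, (u (n + j)).F ≤ ⨆ n, (u n).F) hy) z
    ((iSup_le fun n => le_iSup (fun n => (v n).F) (n + j) : ⨆ n, (v (n + j)).F ≤ ⨆ n, (v n).F) hz)
  have hyh : y ∈ high x (u j).s := (hu.tail j).iSup_F_le_high (by simp) hy
  have hzh : z ∈ high x (u j).s := (hv.tail j).iSup_F_le_high (by simp [hs]) hz
  have hG : hi (fun n => (u n).G) j ≤ ⨆ n, (u (n + j)).G := iSup₂_le fun i hi => by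
    obtain ⟨n, rfl⟩ := Nat.exists_eq_add_of_le' hi
    exact le_iSup (fun n => (u (n + j)).G) n
  have key : Metric.infDist (y - z) (⨆ n, (u (n + j)).G : Submodule ℝ X) / 3 ≤
      Metric.infDist (y - z) (⨆ n, (u n).G : Submodule ℝ X) := by
    refine le_infDist_of_forall fun g hg => ?_
    rw [← lo_sup_hi j] at hg
    obtain ⟨g₁, hg₁, g₂, hg₂, rfl⟩ := Submodule.mem_sup.1 hg
    have h1 := infDist_le_norm_sub (hG hg₂) (y - z)
    have h2 := hx.2 (u j).s g₁ (hu.isBlocks.lo_le j (iSup_mono_lo hu.isBlocks.le j hg₁))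
      (g₂ - (y - z)) (sub_mem (hu.isBlocks.hi_le j (iSup_mono_hi hu.isBlocks.le j hg₂))
        (sub_mem hyh hzh))
    have h3 : ‖g₁ + (g₂ - (y - z))‖ = ‖y - z - (g₁ + g₂)‖ := by
      rw [← norm_neg]; congr 1; abel
    have h4 : y - z - g₂ = y - z - (g₁ + g₂) + g₁ := by abel
    have h5 := norm_add_le (y - z - (g₁ + g₂)) g₁
    rw [← h4] at h5
    linarith
  linarith

theorem IsSeq.restrictedQHI {Y : Type*} [SeminormedAddCommGroup Y] [NormedSpace ℝ Y] [T2Space Y]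
    (hx : BK x) {p : ℕ → Blk X} (hp : IsSeq x p) {φ : X →ₗ[ℝ] Y}
    (hφ : IsRep φ (⨆ n, (p n).F) (⨆ n, (p n).G))
    (hD : ∀ i : ℕ, ¬Dec x (i + 1) ⟨⊥, ⊥, ⊥⟩ p (p i).s) :
    RestrictedQHI fun n => (p n).F.map φ := by
  intro k hk F' G' hGF' hF' _ hdec
  obtain ⟨U, V, hUc, hVc, hU, hV, -, -, -, C, hUV⟩ := hdec
  obtain ⟨ψ, hψ⟩ := exists_isRep (iSup_mono hGF')
  have hclosed : IsClosed ((((⨆ n, G' n).topologicalClosure.comap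
      (⨆ n, F' n).topologicalClosure.subtype : Submodule ℝ (⨆ n, F' n).topologicalClosure)) :
        Set (⨆ n, F' n).topologicalClosure) :=
    (Submodule.isClosed_topologicalClosure _).preimage continuous_subtype_val
  have hT2 : T2Space (fddQS F' G') := by infer_instance
  obtain ⟨F, G, hM, hχ⟩ := exists_isMerge hp hφ hk hGF' hF' hψ
  set χ := ψ ∘ₗ φ
  have hB := hM.isBlocks hp
  obtain ⟨l, m, w, w', hl0, hl, hw, hw'⟩ := exists_pairs hB hχ hU hV
    (ε := fun n => (1 / 2 : ℝ) ^ n / 16) (fun n => by positivity)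
  set C' := max C 0
  have hmain := norm_sub_le_of_pairs hB hx hχ (U := U) (V := V) (C := C') (le_max_right _ _)
    (fun u hu v hv => (hUV u hu v hv).trans (by gcongr; exact le_max_left _ _)) (fun N => by
      rw [← Finset.sum_div]
      linarith [sum_geometric_two_le N]) hl hw hw'
  have hlt : ∀ n, l n < l (n + 1) := fun n => (hl n).1.trans (hl n).2
  have hwF : ∀ n, w n ∈ mid F (l n) (l (n + 1)) := fun n =>
    mid_mono le_rfl (hl n).2.le (hw n).1
  have hwF' : ∀ n, w' n ∈ mid F (l n) (l (n + 1)) := fun n =>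
    mid_mono (hl n).1.le le_rfl (hw' n).1
  have hχG : ∀ g ∈ ⨆ n, G n, χ g = 0 := fun g hg => by
    refine eq_zero_of_norm_eq_zero ?_
    rw [hχ.norm_eq g (iSup_mono hB.le hg)]
    exact Metric.infDist_zero_of_mem hg
  have hnot : ∀ n, ∀ z, ‖χ z‖ = 1 → z ∉ mid G (l n) (l (n + 1)) := fun n z hz hzG => by
    rw [hχG z (mid_le_iSup hzG), norm_zero] at hz
    exact zero_ne_one hz
  let u : (ℕ → X) → ℕ → Blk X := fun w n => ⟨(p (k (l n))).s, (p (k (l (n + 1)))).s,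
    mid G (l n) (l (n + 1)) ⊔ Submodule.span ℝ {w n}, mid G (l n) (l (n + 1))⟩
  have hule : BLe (u w) p := fun n => hM.made hp (hlt n) (hwF n) (hnot n _ (hw n).2.1)
  have hvle : BLe (u w') p := fun n => hM.made hp (hlt n) (hwF' n) (hnot n _ (hw' n).2.1)
  have hu : IsSeq x (u w) := hp.of_made hule fun n => rfl
  have hv : IsSeq x (u w') := hp.of_made hvle fun n => rfl
  have hGsup : ⨆ n, G n ≤ ⨆ n, mid G (l n) (l (n + 1)) := by
    refine iSup_le fun i => ?_
    obtain ⟨n, h1, h2⟩ := exists_between_of_strictMono (n := i) (strictMono_nat_of_lt_succ hlt)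
      (by rw [hl0]; exact Nat.zero_le i)
    exact (le_mid h1 h2).trans (le_iSup (fun n => mid G (l n) (l (n + 1))) n)
  have hsep : IsSep (4 * C' + 3) (⨆ n, (u w n).F) (⨆ n, (u w' n).F) (⨆ n, (u w n).G) := by
    intro y hy z hz
    obtain ⟨g, hg, a, N₁, hN₁⟩ := exists_sum_of_mem_iSup (fun n => mid_le_iSup) hy
    obtain ⟨g', hg', b, N₂, hN₂⟩ := exists_sum_of_mem_iSup (fun n => mid_le_iSup) hz
    have h1 := hmain a b (max N₁ N₂)
    set A := ∑ n ∈ Finset.range (max N₁ N₂), a n • w n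
    set B := ∑ n ∈ Finset.range (max N₁ N₂), b n • w' n
    have e1 : y = g + A := hN₁ _ (le_max_left _ _)
    have e2 : z = g' + B := hN₂ _ (le_max_right _ _)
    have e3 : ∀ y ∈ ⨆ n, F n, ‖χ y‖ ≤ ‖y‖ := fun y hy => by
      rw [hχ.norm_eq y hy]; exact infDist_le_norm _ _
    have hA : A ∈ ⨆ n, F n := sum_mem fun i _ => Submodule.smul_mem _ _ (mid_le_iSup (hwF i))
    have hBm : B ∈ ⨆ n, F n := sum_mem fun i _ => Submodule.smul_mem _ _ (mid_le_iSup (hwF' i))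
    have hy' : y ∈ ⨆ n, F n := e1 ▸ add_mem (iSup_mono hB.le hg) hA
    have hz' : z ∈ ⨆ n, F n := e2 ▸ add_mem (iSup_mono hB.le hg') hBm
    have e4 : χ (y - z) = χ (A - B) := by
      rw [e1, e2, map_sub, map_add, map_add, hχG g hg, hχG g' hg', map_sub, zero_add, zero_add]
    have e5 : χ (y + z) = χ (A + B) := by
      rw [e1, e2, map_add, map_add, map_add, hχG g hg, hχG g' hg', map_add, zero_add, zero_add]
    rw [← e4, ← e5, hχ.norm_eq _ (sub_mem hy' hz')] at h1
    have e6 := e3 _ (add_mem hy' hz')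
    have e7 : (4 * C' + 3) * ‖χ (y + z)‖ ≤ (4 * C' + 3) * ‖y + z‖ := by
      have : 0 ≤ C' := le_max_right _ _
      gcongr
    exact (infDist_anti hGsup _).trans (h1.trans e7)
  obtain ⟨j, hj⟩ := exists_nat_ge (3 * (4 * C' + 3))
  have hlm : StrictMono fun n => k (l n) := hk.1.comp (strictMono_nat_of_lt_succ hlt)
  have hji : (j : ℝ) ≤ (k (l j) : ℕ) := by exact_mod_cast hlm.id_le j
  refine hD (k (l j)) (Dec.mono (C := 3 * (4 * C' + 3)) (by linarith) ?_)
  refine ⟨fun n => u w (n + j), fun n => u w' (n + j), hu.tail j, hv.tail j, hule.tail j,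
    hvle.tail j, by simp [u], fun n => rfl, fun n => rfl, ?_⟩
  simpa only [bot_sup_eq] using hu.isSep_tail hx hv (fun _ => rfl) hsep j

end

theorem IsSchauderBasis.exists_coeff {Y : Type*} [SeminormedAddCommGroup Y]
    [NormedSpace ℝ Y] {e : ℕ → Y} (h : IsSchauderBasis e) :
    ∃ c : Y →ₗ[ℝ] ℕ → ℝ, ∀ y,
      Tendsto (fun N => ∑ n ∈ Finset.range N, c y n • e n) atTop (𝓝 y) := by
  choose c hc hu using h
  refine ⟨⟨⟨c, fun y z => (hu _ _ ?_).symm⟩, fun a y => (hu _ _ ?_).symm⟩, hc⟩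
  · simpa only [Pi.add_apply, add_smul, Finset.sum_add_distrib] using (hc y).add (hc z)
  · simpa only [Pi.smul_apply, smul_eq_mul, mul_smul, ← Finset.smul_sum, RingHom.id_apply]
      using (hc y).const_smul a

section
variable {Y : Type*} [SeminormedAddCommGroup Y] [NormedSpace ℝ Y] [T2Space Y]

theorem isClosed_of_norm_le {U V : Submodule ℝ Y} (htop : U ⊔ V = ⊤) {C : ℝ}
    (h : ∀ u ∈ U, ∀ v ∈ V, ‖v‖ ≤ C * ‖u + v‖) : IsClosed (U : Set Y) := by
  refine isClosed_of_closure_subset fun y hy => ?_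
  have : y ∈ U ⊔ V := by rw [htop]; trivial
  obtain ⟨u, hu, v, hv, rfl⟩ := Submodule.mem_sup.1 this
  suffices hv0 : v = 0 by rw [hv0, add_zero]; exact hu
  refine eq_zero_of_norm_eq_zero (le_antisymm (le_of_forall_pos_le_add fun ε hε => ?_)
    (norm_nonneg v))
  obtain ⟨a, ha, hya⟩ := Metric.mem_closure_iff.1 hy (ε / (|C| + 1)) (by positivity)
  rw [dist_eq_norm] at hya
  have h1 := h (u - a) (sub_mem hu ha) v hv
  rw [show u - a + v = u + v - a by abel] at h1
  rw [lt_div_iff₀ (by positivity)] at hya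
  have := mul_le_mul_of_nonneg_right (le_abs_self C) (norm_nonneg (u + v - a))
  nlinarith [norm_nonneg (u + v - a)]

theorem IsUnconditionalSchauderBasis.decomposable {e : ℕ → Y} {C : ℝ}
    (h : IsUnconditionalSchauderBasis C e) : Decomposable Y := by
  obtain ⟨h, hC, hunc⟩ := h
  obtain ⟨c, hc⟩ := h.exists_coeff
  have hcu : ∀ y d, Tendsto (fun N => ∑ n ∈ Finset.range N, d n • e n) atTop (𝓝 y) → c y = d :=
    fun y d hd => (h y).unique (hc y) hd
  have hce : ∀ n, c (e n) = Pi.single n 1 := by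
    intro n
    refine hcu _ _ (tendsto_atTop_of_eventually_const (i₀ := n + 1) fun N hN => ?_)
    rw [Finset.sum_eq_single n]
    · simp
    · intro i _ hi; simp [hi]
    · intro hn; exact absurd (Finset.mem_range.2 hN) hn
  let W : (ℕ → Prop) → Submodule ℝ Y := fun P =>
    ⨅ n, ⨅ _ : P n, (LinearMap.proj n ∘ₗ c).ker
  have hW : ∀ P y, y ∈ W P ↔ ∀ n, P n → c y n = 0 := fun P y => by
    simp [W, Submodule.mem_iInf]
  have hinf : ∀ (P : ℕ → Prop) (k : ℕ → ℕ), k.Injective → (∀ n, ¬P (k n)) →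
      ¬FiniteDimensional ℝ (W P) := by
    intro P k hk hP hfin
    have hmem : ∀ n, e (k n) ∈ W P := fun n => (hW P _).2 fun i hi => by
      rw [hce, Pi.single_eq_of_ne]
      rintro rfl
      exact hP n hi
    have h1 : LinearIndependent ℝ fun n => (⟨e (k n), hmem n⟩ : W P) := by
      refine LinearIndependent.of_comp (c ∘ₗ (W P).subtype) ?_
      have h2 : LinearIndependent ℝ fun n : ℕ => (Pi.single n 1 : ℕ → ℝ) :=
        Pi.linearIndependent_single_one ℕ ℝ
      have h3 := h2.comp k hk
      convert h3 using 1
      funext n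
      exact hce (k n)
    have := h1.finite
    exact not_finite ℕ
  let ε : ℕ → ℝ := fun n => if Even n then 1 else -1
  have hε : ∀ n, ε n = 1 ∨ ε n = -1 := fun n => by
    simp only [ε]; split_ifs <;> simp
  let U := W fun n => ¬Even n
  let V := W fun n => Even n
  have hflip : ∀ u ∈ U, ∀ v ∈ V, ‖u - v‖ ≤ C * ‖u + v‖ := by
    intro u hu v hv
    obtain ⟨y, hy, hyn⟩ := hunc _ _ (hc (u + v)) ε hε
    have : u - v = y := by
      refine tendsto_nhds_unique (hc (u - v)) ?_
      convert hy using 5 with N n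
      rw [map_sub, map_add, Pi.sub_apply, Pi.add_apply]
      by_cases hn : Even n
      · have := (hW _ _).1 hv n hn
        simp [ε, hn, this]
      · have := (hW _ _).1 hu n hn
        simp [ε, hn, this]
    rw [this]
    exact hyn
  have hle1 : ∀ u ∈ U, ∀ v ∈ V, ‖u‖ ≤ (C + 1) * ‖u + v‖ := by
    intro u hu v hv
    have h1 := hflip u hu v hv
    have h2 : (2 : ℝ) * ‖u‖ = ‖(u + v) + (u - v)‖ := by
      rw [show (u + v) + (u - v) = (2 : ℝ) • u by rw [two_smul]; abel, norm_smul]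
      norm_num
    have h3 := norm_add_le (u + v) (u - v)
    nlinarith [norm_nonneg u]
  have hle2 : ∀ u ∈ U, ∀ v ∈ V, ‖v‖ ≤ (C + 2) * ‖u + v‖ := by
    intro u hu v hv
    have h1 := hle1 u hu v hv
    have h2 := norm_sub_le (u + v) u
    rw [add_sub_cancel_left] at h2
    linarith
  have htop : U ⊔ V = ⊤ := by
    refine eq_top_iff.2 fun y _ => ?_
    obtain ⟨z, hz, -⟩ := hunc _ _ (hc y) ε hε
    have hcz := hcu z _ hz
    have hyz : y = (1 / 2 : ℝ) • (y + z) + (1 / 2 : ℝ) • (y - z) := by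
      rw [← smul_add, show (y + z) + (y - z) = (2 : ℝ) • y by rw [two_smul]; abel, smul_smul]
      norm_num
    rw [hyz]
    refine Submodule.add_mem_sup (Submodule.smul_mem _ _ ?_) (Submodule.smul_mem _ _ ?_)
    · refine (hW _ _).2 fun n hn => ?_
      simp [hcz, ε, hn]
    · refine (hW _ _).2 fun n hn => ?_
      simp [hcz, ε, hn]
  refine ⟨U, V, isClosed_of_norm_le htop hle2, isClosed_of_norm_le (sup_comm U V ▸ htop)
    (fun v hv u hu => by rw [add_comm]; exact hle1 u hu v hv),
    hinf _ (fun n => 2 * n) (fun a b hab => by simpa using hab) (by simp),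
    hinf _ (fun n => 2 * n + 1) (fun a b hab => by simpa using hab) (by simp), htop, ?_, ?_,
    C + 1, hle1⟩
  · refine eq_bot_iff.2 fun y hy => ?_
    rw [Submodule.mem_bot]
    refine eq_zero_of_norm_eq_zero (le_antisymm ?_ (norm_nonneg y))
    simpa using hle1 y hy.1 (-y) (neg_mem hy.2)
  · rw [htop]
    exact isClosed_univ

end

theorem Decomposable.of_isometryEquiv {Y E : Type*} [SeminormedAddCommGroup Y] [NormedSpace ℝ Y]
    [SeminormedAddCommGroup E] [NormedSpace ℝ E] (Ψ : Y ≃ₗᵢ[ℝ] E) (h : Decomposable Y) :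
    Decomposable E := by
  obtain ⟨U, V, hUc, hVc, hU, hV, htop, hbot, -, C, hC⟩ := h
  have hcl : ∀ U : Submodule ℝ Y, IsClosed (U : Set Y) →
      IsClosed ((U.map Ψ.toLinearEquiv.toLinearMap : Submodule ℝ E) : Set E) := fun U hU => by
    rw [Submodule.map_coe]
    exact Ψ.toHomeomorph.isClosed_image.2 hU
  have hfd : ∀ U : Submodule ℝ Y, ¬FiniteDimensional ℝ U →
      ¬FiniteDimensional ℝ (U.map Ψ.toLinearEquiv.toLinearMap) := fun U hU hfin =>
    hU (Module.Finite.equiv (Ψ.toLinearEquiv.submoduleMap U).symm)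
  have htop' : U.map Ψ.toLinearEquiv.toLinearMap ⊔ V.map Ψ.toLinearEquiv.toLinearMap = ⊤ := by
    rw [← Submodule.map_sup, htop, Submodule.map_top]
    exact LinearMap.range_eq_top.2 Ψ.surjective
  refine ⟨_, _, hcl U hUc, hcl V hVc, hfd U hU, hfd V hV, htop', ?_, ?_, C, ?_⟩
  · rw [← Submodule.map_inf _ Ψ.injective, hbot, Submodule.map_bot]
  · rw [htop']; exact isClosed_univ
  · rintro _ ⟨u, hu, rfl⟩ _ ⟨v, hv, rfl⟩
    rw [← map_add]
    have h := hC u hu v hv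
    rw [← Ψ.norm_map u, ← Ψ.norm_map (u + v)] at h
    exact h

section
variable {Y : Type*} [SeminormedAddCommGroup Y] [NormedSpace ℝ Y] [T2Space Y]

theorem exists_isometryEquiv_fddQS {B : ℕ → Submodule ℝ Y} (hB : IsFDD B) :
    Nonempty (Y ≃ₗᵢ[ℝ] fddQS B fun _ => ⊥) := by
  have htop : ∀ y : Y, y ∈ (⨆ n, B n).topologicalClosure := by
    intro y
    obtain ⟨b, hb, -⟩ := hB.2.2 y
    exact mem_closure_of_tendsto hb (Eventually.of_forall fun N =>
      sum_mem fun n _ => le_iSup B n (b n).2)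
  set N := ((⨆ _ : ℕ, (⊥ : Submodule ℝ Y)).topologicalClosure).comap
    ((⨆ n, B n).topologicalClosure).subtype with hN
  have hN0 : N = ⊥ := by
    refine eq_bot_iff.2 fun a ha => ?_
    rw [hN, Submodule.mem_comap, iSup_bot] at ha
    have : (a : Y) ∈ closure ({0} : Set Y) := ha
    rw [closure_singleton] at this
    exact Subtype.ext this
  let ψ : Y →ₗ[ℝ] fddQS B fun _ => ⊥ := N.mkQ ∘ₗ LinearMap.id.codRestrict _ htop
  have hψ : ∀ y, ‖ψ y‖ = ‖y‖ := by
    intro y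
    have h1 : ‖ψ y‖ = Metric.infDist (⟨y, htop y⟩ : (⨆ n, B n).topologicalClosure) N :=
      QuotientAddGroup.norm_mk _
    rw [h1, hN0, Submodule.bot_coe, Metric.infDist_singleton, dist_zero_right]
    rfl
  refine ⟨⟨LinearEquiv.ofBijective ψ ⟨?_, ?_⟩, hψ⟩⟩
  · refine (injective_iff_map_eq_zero ψ).2 fun y hy => eq_zero_of_norm_eq_zero ?_
    rw [← hψ, hy, norm_zero]
  · intro z
    obtain ⟨a, rfl⟩ := N.mkQ_surjective z
    exact ⟨a, rfl⟩

theorem IsUnconditionalSchauderBasis.not_restrictedQHI {e : ℕ → Y} {C : ℝ}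
    (h : IsUnconditionalSchauderBasis C e) {B : ℕ → Submodule ℝ Y} (hB : IsFDD B) :
    ¬RestrictedQHI B := by
  intro hQ
  obtain ⟨Ψ⟩ := exists_isometryEquiv_fddQS hB
  refine hQ id ⟨strictMono_id, rfl⟩ B (fun _ => ⊥) (fun _ => bot_le) (fun n => ?_) (fun hfin => ?_)
    (h.decomposable.of_isometryEquiv Ψ)
  · exact le_iSup₂_of_le n (by simp) le_rfl
  · exact hB.not_finiteDimensional (Module.Finite.equiv Ψ.toLinearEquiv.symm)

end

theorem exists_hereditarily_separated_or {X : Type*} [NormedAddCommGroup X] [NormedSpace ℝ X]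
    {x : ℕ → X} (hx : BK x) :
    (∃ p C, IsSeq x p ∧ 1 ≤ C ∧ ∀ r, IsSeq x r → BLe r p → (r 0).s = (p 0).s →
      Dec x C ⟨⊥, ⊥, ⊥⟩ r (p 0).s) ∨
    ∃ p, IsSeq x p ∧ ∀ i : ℕ, ¬Dec x (i + 1) ⟨⊥, ⊥, ⊥⟩ p (p i).s := by
  refine or_iff_not_imp_left.2 fun hA => ?_
  push Not at hA
  have hp₀ : IsSeq x fun n => ⟨n, n + 1, Submodule.span ℝ {x n}, ⊥⟩ := fun n =>
    ⟨n.lt_succ_self, rfl, bot_lt_iff_ne_bot.2 (by simpa using hx.1 n), by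
      rw [Submodule.span_singleton_le_iff_mem]
      exact Submodule.subset_span ⟨n, ⟨le_rfl, n.lt_succ_self⟩, rfl⟩⟩
  refine (fusion (x := x) (fun p k => ¬Dec x (k + 1) ⟨⊥, ⊥, ⊥⟩ p (p k).s) ?_ ?_ _ hp₀).imp
    fun p h => ⟨h.1, h.2.2.2⟩
  · intro p hp k
    obtain ⟨r, hr, hrp, hr0, hrD⟩ := hA (fun n => p (n + k)) (k + 1) (hp.tail k)
      (by linarith [k.cast_nonneg (α := ℝ)])
    rw [zero_add] at hr0 hrD
    have href := refines_splice hp hr (hrp.trans (hp.refl.tail k) (hp.tail k) hp) hr0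
    refine ⟨_, href, fun hD => hrD ?_⟩
    have := hD.tail href.isSeq rfl
    rwa [splice_tail, href.s_eq] at this
  · intro p p' k hp href hD hD'
    rw [href.eq k k.lt_succ_self] at hD'
    exact hD (hD'.below href.isSeq hp href.le)

/-- **Main theorem.** Every infinite-dimensional Banach space `X` has an
infinite-dimensional quotient of subspace `Y = Z/W` (`W ⊆ Z ⊆ X` closed subspaces)
satisfying one of the two following mutually exclusive properties:
(i) `Y` has an unconditional Schauder basis;
(ii) `Y` admits a finite-dimensional decomposition with respect to which `Y` has the
restricted QHI property. -/
theorem QS_dichotomy (X : Type*) [NormedAddCommGroup X] [NormedSpace ℝ X]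
    [CompleteSpace X] (hX : ¬FiniteDimensional ℝ X) :
    ∃ Z W : Submodule ℝ X, IsClosed (Z : Set X) ∧ IsClosed (W : Set X) ∧ W ≤ Z ∧
      ¬FiniteDimensional ℝ (↥Z ⧸ W.comap Z.subtype) ∧
      ((∃ (C : ℝ) (e : ℕ → ↥Z ⧸ W.comap Z.subtype), IsUnconditionalSchauderBasis C e) ∨
        (∃ B : ℕ → Submodule ℝ (↥Z ⧸ W.comap Z.subtype), IsFDD B ∧ RestrictedQHI B)) ∧
      ¬((∃ (C : ℝ) (e : ℕ → ↥Z ⧸ W.comap Z.subtype), IsUnconditionalSchauderBasis C e) ∧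
        (∃ B : ℕ → Submodule ℝ (↥Z ⧸ W.comap Z.subtype), IsFDD B ∧ RestrictedQHI B)) := by
  obtain ⟨x, hx⟩ := exists_BK X hX
  obtain ⟨p, hp, h⟩ : ∃ p : ℕ → Blk X, IsSeq x p ∧
      ∀ (Y : Type _) [SeminormedAddCommGroup Y] [NormedSpace ℝ Y] [T2Space Y] [CompleteSpace Y]
        (φ : X →ₗ[ℝ] Y), IsRep φ (⨆ n, (p n).F) (⨆ n, (p n).G) →
        ((∃ (C : ℝ) (e : ℕ → Y), IsUnconditionalSchauderBasis C e) ∨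
          ∃ B : ℕ → Submodule ℝ Y, IsFDD B ∧ RestrictedQHI B) := by
    rcases exists_hereditarily_separated_or hx with ⟨p, C, hp, hC, h⟩ | ⟨p, hp, h⟩
    · obtain ⟨z, hz, hsep⟩ := exists_unconditional_blocks hx hC hp h
      obtain ⟨z', ζ, hz', hG, hζ, hF⟩ := exists_thin hz
      refine ⟨z', hz', fun Y _ _ _ _ φ hφ => Or.inl ⟨2 * (C + 1), fun n => φ (ζ n), ?_⟩⟩
      exact (exists_unconditional_basis hx hz hz' hG hζ hF (by linarith) hsep hφ).2
    · refine ⟨p, hp, fun Y _ _ _ _ φ hφ => Or.inr ⟨_, hp.isFDD hx hφ, ?_⟩⟩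
      exact hp.restrictedQHI hx hφ h
  set S := ⨆ n, (p n).F
  set T := ⨆ n, (p n).G
  have hTS : T ≤ S := iSup_mono hp.G_le_F
  have hT : IsClosed (T.topologicalClosure : Set X) := Submodule.isClosed_topologicalClosure _
  have hS : IsClosed (S.topologicalClosure : Set X) := Submodule.isClosed_topologicalClosure _
  have hcl : IsClosed ((T.topologicalClosure.comap S.topologicalClosure.subtype :
      Submodule ℝ S.topologicalClosure) : Set S.topologicalClosure) :=
    hT.preimage continuous_subtype_val
  have hcS : CompleteSpace S.topologicalClosure := hS.completeSpace_coe
  have hT2 : T2Space (S.topologicalClosure ⧸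
    T.topologicalClosure.comap S.topologicalClosure.subtype) := by infer_instance
  obtain ⟨φ, hφ⟩ := exists_isRep hTS
  refine ⟨S.topologicalClosure, T.topologicalClosure, hS, hT,
    Submodule.topologicalClosure_mono hTS, (hp.isFDD hx hφ).not_finiteDimensional,
    h _ φ hφ, ?_⟩
  rintro ⟨⟨C, e, he⟩, B, hB, hQ⟩
  exact he.not_restrictedQHI hB hQ

end
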